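/- arXiv:1602.07313 — 8 statements merged into one kernel-verified Lean document; each statement's English description precedes it below -/
import Mathlib

section
/- Let B_n(f,x) := Σ_{k=0}^n f(k/n) p_{n,k}(x) be the classical Bernstein polynomial. There exist an absolute constant c₀ > 0 and, for each λ ∈ [0,2), a constant c > 0 depending only on λ, such that for all n ∈ ℕ, f ∈ C[0,1], x ∈ [0,1] and 0 < h ≤ c₀: |f(x) − B_n(f,x)| ≤ c (1 + φ^{2−λ}(x) / (h² n (φ(x) + n^{−1/2})^λ)) ω₂^{φ^λ}(f,h). In particular, |f(x) − B_n(f,x)| ≤ c ω₂^{φ^λ}(f, n^{−1/2} φ^{1−λ/2}(x) (φ(x) + n^{−1/2})^{−λ/2}) for all f ∈ C[0,1] and x ∈ [0,1]. -/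
noncomputable section

open Set Finset
open scoped Classical

/-- The interval `[0,1]`. -/
def I01 : Set ℝ := Set.Icc 0 1

/-- `φ(x) = √(x(1-x))`. -/
def phi (x : ℝ) : ℝ := Real.sqrt (x * (1 - x))

/-- The `k`-th symmetric difference of `f` with step `δ`. -/
def centralDiff (k : ℕ) (δ : ℝ) (f : ℝ → ℝ) (x : ℝ) : ℝ :=
  if (x - k * δ / 2) ∈ I01 ∧ (x + k * δ / 2) ∈ I01 then
    ∑ i ∈ Finset.range (k + 1),
      (k.choose i : ℝ) * (-1 : ℝ) ^ (k - i) * f (x - k * δ / 2 + i * δ)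
  else 0

/-- The second Ditzian–Totik modulus of smoothness with step-weight `ψ`. -/
def omega2 (ψ : ℝ → ℝ) (f : ℝ → ℝ) (t : ℝ) : ℝ :=
  sSup {v : ℝ | ∃ s x : ℝ, 0 < s ∧ s ≤ t ∧ x ∈ I01 ∧ v = |centralDiff 2 (s * ψ x) f x|}

/-- `f` is `k`-monotone on `[0,1]`. -/
def kMono (k : ℕ) (f : ℝ → ℝ) : Prop :=
  ∀ δ : ℝ, 0 < δ → ∀ x ∈ I01, 0 ≤ centralDiff k δ f x

/-- `g` coincides (on all of `ℝ`) with an algebraic polynomial of degree at most `n`. -/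
def IsPolyOfDegLe (n : ℕ) (g : ℝ → ℝ) : Prop :=
  ∃ p : Polynomial ℝ, p.natDegree ≤ n ∧ ∀ x, g x = p.eval x

/-- `L` is a positive linear operator `C[0,1] → C[0,1]`. -/
def PositiveLinearOp (L : (ℝ → ℝ) → (ℝ → ℝ)) : Prop :=
  (∀ f g : ℝ → ℝ, ContinuousOn f I01 → ContinuousOn g I01 →
      ∀ x ∈ I01, L (fun y => f y + g y) x = L f x + L g x) ∧
  (∀ (a : ℝ) (f : ℝ → ℝ), ContinuousOn f I01 →
      ∀ x ∈ I01, L (fun y => a * f y) x = a * L f x) ∧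
  (∀ f : ℝ → ℝ, ContinuousOn f I01 → ContinuousOn (L f) I01) ∧
  (∀ f : ℝ → ℝ, ContinuousOn f I01 → (∀ x ∈ I01, 0 ≤ f x) → ∀ x ∈ I01, 0 ≤ L f x)

/-- The Bernstein fundamental polynomials `p_{n,k}(x) = C(n,k) x^k (1-x)^{n-k}`. -/
def bern (n k : ℕ) (x : ℝ) : ℝ := (n.choose k : ℝ) * x ^ k * (1 - x) ^ (n - k)

/-- The classical Bernstein polynomial of `f`. -/
def bernsteinOp (n : ℕ) (f : ℝ → ℝ) (x : ℝ) : ℝ :=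
  ∑ k ∈ Finset.range (n + 1), f ((k : ℝ) / (n : ℝ)) * bern n k x

/-! ### Power functions -/

/-- Second order lower bound for a concave power at `1`. -/
lemma one_add_mul_sub_sq_le_rpow {p s : ℝ} (hp0 : 0 ≤ p) (hp1 : p ≤ 1) (hs : 0 ≤ s) :
    1 + p * (s - 1) - (s - 1) ^ 2 ≤ s ^ p := by
  rcases hs.eq_or_lt with rfl | hs
  · have := Real.rpow_nonneg le_rfl p
    nlinarith
  · have hb : s ^ (1 - p) ≤ 1 + (1 - p) * (s - 1) := by
      simpa using rpow_one_add_le_one_add_mul_self (s := s - 1) (by linarith)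
        (p := 1 - p) (by linarith) (by linarith)
    have hsp : s ^ p * s ^ (1 - p) = s := by
      rw [← Real.rpow_add hs]; simp
    have hpos : 0 < 1 + (1 - p) * (s - 1) := lt_of_lt_of_le (Real.rpow_pos_of_pos hs _) hb
    refine le_of_mul_le_mul_right ?_ hpos
    have h1 : s ≤ s ^ p * (1 + (1 - p) * (s - 1)) := by
      calc s = s ^ p * s ^ (1 - p) := hsp.symm
        _ ≤ _ := by gcongr
    refine le_trans ?_ h1
    have h2 : 0 ≤ (s - 1) ^ 2 * (p ^ 2 + (1 - p) * s) :=
      mul_nonneg (sq_nonneg _) (add_nonneg (sq_nonneg _) (mul_nonneg (by linarith) hs.le))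
    nlinarith

lemma rpow_quadratic_lower_bound {p x t : ℝ} (hp0 : 0 ≤ p) (hp1 : p ≤ 1) (hx : 0 < x)
    (ht : 0 ≤ t) :
    x ^ p + p * x ^ (p - 1) * (t - x) - x ^ (p - 2) * (t - x) ^ 2 ≤ t ^ p := by
  have h := one_add_mul_sub_sq_le_rpow hp0 hp1 (div_nonneg ht hx.le)
  have e1 : x ^ (p - 1) = x ^ p / x := by rw [Real.rpow_sub hx, Real.rpow_one]
  have e2 : x ^ (p - 2) = x ^ p / x ^ 2 := by rw [Real.rpow_sub hx, Real.rpow_two]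
  rw [Real.div_rpow ht hx.le] at h
  have hxp := Real.rpow_pos_of_pos hx p
  calc _ = x ^ p * (1 + p * (t / x - 1) - (t / x - 1) ^ 2) := by
        rw [e1, e2]; field_simp
    _ ≤ x ^ p * (t ^ p / x ^ p) := by gcongr
    _ = t ^ p := by field_simp

/-- The second difference of a power with exponent at most `1 / 2`. -/
lemma rpow_second_diff_le {p z δ : ℝ} (hp0 : 0 ≤ p) (hp1 : p ≤ 1 / 2) (hz : 0 < z)
    (hδ0 : 0 ≤ δ) (hδ : δ ≤ z) :
    (z - δ) ^ p + (z + δ) ^ p - 2 * z ^ p ≤ -(p / 2 * z ^ (p - 2) * δ ^ 2) := by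
  set r := δ / z with hr
  have hr0 : 0 ≤ r := by positivity
  have hr1 : r ≤ 1 := (div_le_one hz).2 hδ
  have hδr : δ = z * r := by rw [hr]; field_simp
  have e2 : z ^ (p - 2) = z ^ p / z ^ 2 := by rw [Real.rpow_sub hz, Real.rpow_two]
  have ha : (z - δ) ^ p = z ^ p * (1 - r) ^ p := by
    rw [← Real.mul_rpow hz.le (by linarith), hδr]; ring_nf
  have hb : (z + δ) ^ p = z ^ p * (1 + r) ^ p := by
    rw [← Real.mul_rpow hz.le (by linarith), hδr]; ring_nf
  have key : (1 - r) ^ p + (1 + r) ^ p ≤ 2 - p / 2 * r ^ 2 := by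
    have h1 : ((1 - r) ^ p) ^ 2 ≤ 1 - 2 * p * r := by
      have := rpow_one_add_le_one_add_mul_self (s := -r) (by linarith) (p := p * 2)
        (by linarith) (by linarith)
      rw [← sub_eq_add_neg, Real.rpow_mul (by linarith), Real.rpow_two] at this
      linarith
    have h2 : ((1 + r) ^ p) ^ 2 ≤ 1 + 2 * p * r := by
      have := rpow_one_add_le_one_add_mul_self (s := r) (by linarith) (p := p * 2)
        (by linarith) (by linarith)
      rw [Real.rpow_mul (by linarith), Real.rpow_two] at this
      linarith
    have h3 : (1 - r) ^ p * (1 + r) ^ p ≤ 1 - p * r ^ 2 := by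
      have := rpow_one_add_le_one_add_mul_self (s := -r ^ 2) (by nlinarith) (p := p)
        (by linarith) (by linarith)
      rw [← Real.mul_rpow (by linarith) (by linarith)]
      calc _ = (1 + -r ^ 2) ^ p := by ring_nf
        _ ≤ _ := by linarith
    refine abs_le_of_sq_le_sq' ?_ ?_ |>.2
    · nlinarith [sq_nonneg (p / 2 * r ^ 2)]
    · nlinarith
  rw [ha, hb, e2, hδr]
  have hzp := Real.rpow_pos_of_pos hz p
  calc z ^ p * (1 - r) ^ p + z ^ p * (1 + r) ^ p - 2 * z ^ p
      = z ^ p * ((1 - r) ^ p + (1 + r) ^ p - 2) := by ring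
    _ ≤ z ^ p * (-(p / 2 * r ^ 2)) := by gcongr; linarith
    _ = _ := by field_simp

/-! ### The Bernstein operator -/

lemma bern_eq_eval (n k : ℕ) (x : ℝ) : bern n k x = (bernsteinPolynomial ℝ n k).eval x := by
  simp [bern, bernsteinPolynomial]

lemma bern_nonneg {n k : ℕ} {x : ℝ} (hx : x ∈ I01) : 0 ≤ bern n k x := by
  have h0 : 0 ≤ x := hx.1
  have h1 : 0 ≤ 1 - x := sub_nonneg.2 hx.2
  unfold bern
  positivity

lemma sum_bern (n : ℕ) (x : ℝ) : ∑ k ∈ Finset.range (n + 1), bern n k x = 1 := by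
  simpa [Polynomial.eval_finsetSum, bern_eq_eval] using
    congrArg (Polynomial.eval x) (bernsteinPolynomial.sum ℝ n)

lemma sum_sub_mul_bern {n : ℕ} (hn : n ≠ 0) (x : ℝ) :
    ∑ k ∈ Finset.range (n + 1), ((k : ℝ) / n - x) * bern n k x = 0 := by
  have hn' : (n : ℝ) ≠ 0 := by exact_mod_cast hn
  have h : ∑ k ∈ Finset.range (n + 1), (k : ℝ) * bern n k x = n * x := by
    simpa [Polynomial.eval_finsetSum, bern_eq_eval] using
      congrArg (Polynomial.eval x) (bernsteinPolynomial.sum_smul ℝ n)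
  calc _ = (∑ k ∈ Finset.range (n + 1), (k : ℝ) * bern n k x) / n
        - x * ∑ k ∈ Finset.range (n + 1), bern n k x := by
        rw [Finset.sum_div, Finset.mul_sum, ← Finset.sum_sub_distrib]
        exact Finset.sum_congr rfl fun k _ => by ring
    _ = 0 := by rw [h, sum_bern]; field_simp; ring

lemma sum_sub_sq_mul_bern {n : ℕ} (hn : n ≠ 0) (x : ℝ) :
    ∑ k ∈ Finset.range (n + 1), ((k : ℝ) / n - x) ^ 2 * bern n k x = x * (1 - x) / n := by
  have hn' : (n : ℝ) ≠ 0 := by exact_mod_cast hn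
  have h : ∑ k ∈ Finset.range (n + 1), (n * x - k) ^ 2 * bern n k x = n * x * (1 - x) := by
    simpa [Polynomial.eval_finsetSum, bern_eq_eval] using
      congrArg (Polynomial.eval x) (bernsteinPolynomial.variance ℝ n)
  calc _ = (∑ k ∈ Finset.range (n + 1), (n * x - k) ^ 2 * bern n k x) / n ^ 2 := by
        rw [Finset.sum_div]
        refine Finset.sum_congr rfl fun k _ => ?_
        field_simp
        ring
    _ = _ := by rw [h]; field_simp

/-- A quadratic minorant of `g` gives a lower bound for its Bernstein polynomial. -/
lemma le_bernsteinOp_of_quadratic_le {n : ℕ} (hn : n ≠ 0) {x : ℝ} (hx : x ∈ I01) {g : ℝ → ℝ}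
    {A l q : ℝ} (hg : ∀ t ∈ I01, A + l * (t - x) + q * (t - x) ^ 2 ≤ g t) :
    A + q * (x * (1 - x) / n) ≤ bernsteinOp n g x := by
  have hn' : (0 : ℝ) < n := by exact_mod_cast Nat.pos_of_ne_zero hn
  calc A + q * (x * (1 - x) / n)
      = ∑ k ∈ Finset.range (n + 1),
          (A + l * ((k : ℝ) / n - x) + q * ((k : ℝ) / n - x) ^ 2) * bern n k x := by
        simp only [add_mul, Finset.sum_add_distrib, mul_assoc, ← Finset.mul_sum]
        rw [sum_bern, sum_sub_mul_bern hn, sum_sub_sq_mul_bern hn]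
        ring
    _ ≤ bernsteinOp n g x := by
        refine Finset.sum_le_sum fun k hk => ?_
        refine mul_le_mul_of_nonneg_right (hg _ ⟨by positivity, ?_⟩) (bern_nonneg hx)
        rw [div_le_one hn']
        exact_mod_cast Finset.mem_range_succ_iff.1 hk

lemma bernsteinOp_neg (n : ℕ) (f : ℝ → ℝ) (x : ℝ) :
    bernsteinOp n (fun t => -f t) x = -bernsteinOp n f x := by
  simp [bernsteinOp]

lemma bernsteinOp_zero {n : ℕ} (f : ℝ → ℝ) : bernsteinOp n f 0 = f 0 := by
  unfold bernsteinOp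
  rw [Finset.sum_eq_single 0] <;> simp +contextual [bern]

lemma bernsteinOp_one {n : ℕ} (hn : n ≠ 0) (f : ℝ → ℝ) : bernsteinOp n f 1 = f 1 := by
  have hn' : (n : ℝ) ≠ 0 := by exact_mod_cast hn
  unfold bernsteinOp
  rw [Finset.sum_eq_single n]
  · simp [bern, hn']
  · intro k hk hkn
    have : k < n := lt_of_le_of_ne (Finset.mem_range_succ_iff.1 hk) hkn
    simp [bern, Nat.sub_ne_zero_of_lt this]
  · simp

/-! ### A maximum principle for approximately convex functions -/

/-- If the second differences of `G` are at least `-W` for all steps up to `D z`, and positive for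
the step `D z`, then `G` exceeds its zero boundary values by at most `W`. -/
lemma le_of_second_diff_of_boundary_zero {a b W : ℝ} {G D : ℝ → ℝ} (hW : 0 ≤ W)
    (hG : ContinuousOn G (Set.Icc a b)) (ha : G a = 0) (hb : G b = 0)
    (hD : ∀ z ∈ Set.Ioo a b, 0 < D z)
    (hsmall : ∀ z ∈ Set.Ioo a b, ∀ δ, 0 < δ → δ ≤ D z → a ≤ z - δ → z + δ ≤ b →
      -W ≤ G (z - δ) - 2 * G z + G (z + δ))
    (hlarge : ∀ z ∈ Set.Ioo a b, a ≤ z - D z → z + D z ≤ b →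
      0 < G (z - D z) - 2 * G z + G (z + D z))
    {t : ℝ} (ht : t ∈ Set.Icc a b) : G t ≤ W := by
  obtain ⟨z, hz, hmax⟩ := isCompact_Icc.exists_isMaxOn ⟨t, ht⟩ hG
  have hm : ∀ u, a ≤ u → u ≤ b → G u ≤ G z := fun u h1 h2 => hmax ⟨h1, h2⟩
  refine (hm t ht.1 ht.2).trans ?_
  by_contra! hcon
  have hza : a < z := lt_of_le_of_ne hz.1 (by rintro rfl; linarith)
  have hzb : z < b := lt_of_le_of_ne hz.2 (by rintro rfl; linarith)
  have hDz := hD z ⟨hza, hzb⟩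
  by_cases hfit : a ≤ z - D z ∧ z + D z ≤ b
  · have h1 := hlarge z ⟨hza, hzb⟩ hfit.1 hfit.2
    have h2 := hm (z - D z) hfit.1 (by linarith)
    have h3 := hm (z + D z) (by linarith) hfit.2
    linarith
  · rcases le_total (z - a) (b - z) with hle | hle
    · have hd : z - a ≤ D z := by
        by_contra! h
        exact hfit ⟨by linarith, by linarith⟩
      have h1 := hsmall z ⟨hza, hzb⟩ (z - a) (by linarith) hd (by linarith) (by linarith)
      have h2 := hm (z + (z - a)) (by linarith) (by linarith)
      rw [show z - (z - a) = a by ring, ha] at h1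
      linarith
    · have hd : b - z ≤ D z := by
        by_contra! h
        exact hfit ⟨by linarith, by linarith⟩
      have h1 := hsmall z ⟨hza, hzb⟩ (b - z) (by linarith) hd (by linarith) (by linarith)
      have h2 := hm (z - (b - z)) (by linarith) (by linarith)
      rw [show z + (b - z) = b by ring, hb] at h1
      linarith

/-- A function on `[0,1]` satisfying the hypotheses of the maximum principle has, up to the
error `W`, a supporting line at every interior point. -/
lemma exists_approx_supporting_line {W : ℝ} {F D : ℝ → ℝ} (hW : 0 ≤ W)
    (hF : ContinuousOn F I01) (hD : ∀ z ∈ Set.Ioo (0 : ℝ) 1, 0 < D z)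
    (hsmall : ∀ z ∈ Set.Ioo (0 : ℝ) 1, ∀ δ, 0 < δ → δ ≤ D z → 0 ≤ z - δ → z + δ ≤ 1 →
      -W ≤ F (z - δ) - 2 * F z + F (z + δ))
    (hlarge : ∀ z ∈ Set.Ioo (0 : ℝ) 1, 0 ≤ z - D z → z + D z ≤ 1 →
      0 < F (z - D z) - 2 * F z + F (z + D z))
    {x : ℝ} (hx : x ∈ Set.Ioo (0 : ℝ) 1) :
    ∃ l, ∀ t ∈ I01, F x - W + l * (t - x) ≤ F t := by
  have hchord : ∀ a b, 0 ≤ a → a < x → x < b → b ≤ 1 →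
      (F x - W - F a) / (x - a) ≤ (F b - F x + W) / (b - x) := by
    intro a b ha hax hxb hb
    have hab : 0 < b - a := by linarith
    set m := (F b - F a) / (b - a) with hm
    have hmul : m * (b - a) = F b - F a := by rw [hm]; field_simp
    have hsub : Set.Ioo a b ⊆ Set.Ioo (0 : ℝ) 1 := Set.Ioo_subset_Ioo ha hb
    have key := le_of_second_diff_of_boundary_zero (a := a) (b := b)
      (G := fun t => F t - F a - m * (t - a)) (D := D) hW
      (by
        have : ContinuousOn F (Set.Icc a b) := hF.mono (Set.Icc_subset_Icc ha hb)
        fun_prop)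
      (by ring) (by linarith) (fun z hz => hD z (hsub hz))
      (fun z hz δ h0 h1 h2 h3 => by
        have := hsmall z (hsub hz) δ h0 h1 (by linarith) (by linarith)
        linarith)
      (fun z hz h2 h3 => by
        have := hlarge z (hsub hz) (by linarith) (by linarith)
        linarith)
      (t := x) ⟨hax.le, hxb.le⟩
    have hxa : 0 < x - a := by linarith
    have hbx : 0 < b - x := by linarith
    calc (F x - W - F a) / (x - a) ≤ m := by rw [div_le_iff₀ hxa]; linarith
      _ ≤ _ := by rw [le_div_iff₀ hbx]; linarith
  obtain ⟨l, hl1, hl2⟩ := exists_between_of_forall_le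
    (s := (fun a => (F x - W - F a) / (x - a)) '' Set.Ico 0 x)
    (t := (fun b => (F b - F x + W) / (b - x)) '' Set.Ioc x 1)
    ⟨_, Set.mem_image_of_mem _ ⟨le_rfl, hx.1⟩⟩ ⟨_, Set.mem_image_of_mem _ ⟨hx.2, le_rfl⟩⟩
    (by
      rintro _ ⟨a, ha, rfl⟩ _ ⟨b, hb, rfl⟩
      exact hchord a b ha.1 ha.2 hb.1 hb.2)
  refine ⟨l, fun t ht => ?_⟩
  rcases lt_trichotomy t x with h | rfl | h
  · have := hl1 (Set.mem_image_of_mem _ ⟨ht.1, h⟩)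
    rw [div_le_iff₀ (by linarith)] at this
    linarith
  · linarith
  · have := hl2 (Set.mem_image_of_mem _ ⟨h, ht.2⟩)
    rw [le_div_iff₀ (by linarith)] at this
    linarith

/-! ### The barrier function -/

/-- A function of `t` whose second differences with step `h φ^lam` are at least of order `h²`. -/
def barrier (lam p y t : ℝ) : ℝ :=
  y ^ (-lam) * t ^ 2 - y ^ (2 - p - lam) * (t ^ p + (1 - t) ^ p)

lemma continuous_barrier {lam p y : ℝ} (hp : 0 < p) : Continuous (barrier lam p y) := by
  have h1 : Continuous fun t : ℝ => t ^ p := Real.continuous_rpow_const hp.le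
  have h2 : Continuous fun t : ℝ => (1 - t) ^ p := h1.comp (by fun_prop)
  unfold barrier
  fun_prop

lemma barrier_second_diff {lam p y z δ : ℝ} (hp0 : 0 ≤ p) (hp1 : p ≤ 1 / 2) (hy : 0 < y)
    (hδ0 : 0 ≤ δ) (h0 : 0 ≤ z - δ) (h1 : z + δ ≤ 1) (hz0 : 0 < z) (hz1 : z < 1) :
    (2 * y ^ (-lam) + y ^ (2 - p - lam) * (p / 2 * (z ^ (p - 2) + (1 - z) ^ (p - 2)))) * δ ^ 2 ≤
      barrier lam p y (z - δ) - 2 * barrier lam p y z + barrier lam p y (z + δ) := by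
  have a1 := rpow_second_diff_le hp0 hp1 hz0 hδ0 (by linarith)
  have a2 := rpow_second_diff_le (z := 1 - z) hp0 hp1 (by linarith) hδ0 (by linarith)
  rw [show 1 - z - δ = 1 - (z + δ) by ring, show 1 - z + δ = 1 - (z - δ) by ring] at a2
  have hY : 0 < y ^ (2 - p - lam) := Real.rpow_pos_of_pos hy _
  have := mul_le_mul_of_nonneg_left (add_le_add a1 a2) hY.le
  unfold barrier
  linarith

lemma barrier_weight_bound {lam p y m a : ℝ} (hl0 : 0 ≤ lam) (hl2 : lam ≤ 2) (hp0 : 0 ≤ p)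
    (hp1 : p ≤ 1 / 2) (hlp : p + lam ≤ 2) (hy : 0 < y) (hm : 0 < m) (ha : m / 2 ≤ a) :
    p / 8 ≤ (2 * y ^ (-lam) + y ^ (2 - p - lam) * (p / 2 * m ^ (p - 2))) * a ^ lam := by
  have h2 : (2 : ℝ) ^ lam ≤ 4 := by
    calc (2 : ℝ) ^ lam ≤ 2 ^ (2 : ℝ) := Real.rpow_le_rpow_of_exponent_le (by norm_num) hl2
      _ = 4 := by norm_num
  have haM : m ^ lam / 4 ≤ a ^ lam := by
    calc m ^ lam / 4 ≤ m ^ lam / 2 ^ lam := by gcongr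
      _ = (m / 2) ^ lam := (Real.div_rpow hm.le (by norm_num) _).symm
      _ ≤ a ^ lam := by gcongr
  have hmm : m ^ (-lam) * m ^ lam = 1 := by rw [← Real.rpow_add hm]; simp
  have hlow : p / 2 * m ^ (-lam) ≤
      2 * y ^ (-lam) + y ^ (2 - p - lam) * (p / 2 * m ^ (p - 2)) := by
    rcases le_total m y with h | h
    · have e : m ^ (-lam) = m ^ (2 - p - lam) * m ^ (p - 2) := by
        rw [← Real.rpow_add hm]; ring_nf
      have : m ^ (2 - p - lam) ≤ y ^ (2 - p - lam) :=
        Real.rpow_le_rpow hm.le h (by linarith)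
      calc p / 2 * m ^ (-lam) = m ^ (2 - p - lam) * (p / 2 * m ^ (p - 2)) := by rw [e]; ring
        _ ≤ y ^ (2 - p - lam) * (p / 2 * m ^ (p - 2)) := by gcongr
        _ ≤ _ := by have := Real.rpow_nonneg hy.le (-lam); linarith
    · have : m ^ (-lam) ≤ y ^ (-lam) :=
        Real.rpow_le_rpow_of_nonpos hy h (by linarith)
      have h3 := Real.rpow_pos_of_pos hm (-lam)
      calc p / 2 * m ^ (-lam) ≤ 2 * y ^ (-lam) := by nlinarith
        _ ≤ _ := by
          have : 0 ≤ y ^ (2 - p - lam) * (p / 2 * m ^ (p - 2)) := by positivity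
          linarith
  calc p / 8 = p / 2 * m ^ (-lam) * (m ^ lam / 4) := by linear_combination (-p / 8) * hmm
    _ ≤ _ := by gcongr

lemma phi_rpow_sq {z : ℝ} (hz0 : 0 ≤ z) (hz1 : z ≤ 1) (lam : ℝ) :
    (phi z ^ lam) ^ 2 = (z * (1 - z)) ^ lam := by
  have h : 0 ≤ z * (1 - z) := mul_nonneg hz0 (by linarith)
  rw [phi, ← Real.rpow_natCast, ← Real.rpow_mul (Real.sqrt_nonneg _), mul_comm lam,
    Real.rpow_mul (Real.sqrt_nonneg _)]
  simp [Real.sq_sqrt h]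

lemma barrier_second_diff_phi {lam p y z h : ℝ} (hl0 : 0 ≤ lam) (hl2 : lam ≤ 2) (hp0 : 0 ≤ p)
    (hp1 : p ≤ 1 / 2) (hlp : p + lam ≤ 2) (hy : 0 < y) (hz0 : 0 < z) (hz1 : z < 1)
    (hh : 0 < h) (h0 : 0 ≤ z - h * phi z ^ lam) (h1 : z + h * phi z ^ lam ≤ 1) :
    p / 8 * h ^ 2 ≤ barrier lam p y (z - h * phi z ^ lam) - 2 * barrier lam p y z
      + barrier lam p y (z + h * phi z ^ lam) := by
  have hphi : 0 ≤ phi z ^ lam := Real.rpow_nonneg (Real.sqrt_nonneg _) _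
  refine le_trans ?_ (barrier_second_diff hp0 hp1 hy (mul_nonneg hh.le hphi) h0 h1 hz0 hz1)
  rw [mul_pow, phi_rpow_sq hz0.le hz1.le, mul_comm (h ^ 2), ← mul_assoc]
  refine mul_le_mul_of_nonneg_right ?_ (sq_nonneg h)
  have hz1' : 0 < 1 - z := by linarith
  have ha : 0 < (z * (1 - z)) ^ lam := by positivity
  have hA : 0 < z ^ (p - 2) := by positivity
  have hB : 0 < (1 - z) ^ (p - 2) := by positivity
  rcases le_total z (1 / 2) with hz | hz
  · refine (barrier_weight_bound (a := z * (1 - z)) hl0 hl2 hp0 hp1 hlp hy hz0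
      (by nlinarith)).trans ?_
    gcongr
    linarith
  · refine (barrier_weight_bound (a := z * (1 - z)) hl0 hl2 hp0 hp1 hlp hy hz1'
      (by nlinarith)).trans ?_
    gcongr
    linarith

/-- A quadratic minorant of `t ^ p` that is nearly optimal at `x` in the Bernstein mean. -/
lemma exists_quadratic_minorant_rpow {p x y V Y : ℝ} (hp0 : 0 ≤ p) (hp1 : p ≤ 1) (hx : 0 < x)
    (hy : 0 < y) (hV : 0 ≤ V) (hxy : y ≤ 4 * x ∨ y ^ 2 ≤ 4 * V) (hY : 0 ≤ Y) :
    ∃ A l q, (∀ t, 0 ≤ t → A + l * (t - x) - q * (t - x) ^ 2 ≤ t ^ p) ∧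
      Y * y ^ (2 - p) * (x ^ p - A + q * V) ≤ 16 * (Y * V) := by
  by_cases h : y ≤ 4 * x
  · refine ⟨x ^ p, p * x ^ (p - 1), x ^ (p - 2),
      fun t ht => rpow_quadratic_lower_bound hp0 hp1 hx ht, ?_⟩
    have h16 : y ^ (2 - p) * x ^ (p - 2) ≤ 16 := by
      have e : x ^ (p - 2) = (x ^ (2 - p))⁻¹ := by rw [← Real.rpow_neg hx.le]; ring_nf
      rw [e, ← div_eq_mul_inv, ← Real.div_rpow hy.le hx.le]
      calc (y / x) ^ (2 - p) ≤ 4 ^ (2 - p) := by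
            gcongr
            · linarith
            · rwa [div_le_iff₀ hx]
        _ ≤ 4 ^ (2 : ℝ) := Real.rpow_le_rpow_of_exponent_le (by norm_num) (by linarith)
        _ = 16 := by norm_num
    calc _ = y ^ (2 - p) * x ^ (p - 2) * (Y * V) := by ring
      _ ≤ _ := by gcongr
  · refine ⟨0, 0, 0, fun t ht => by simpa using Real.rpow_nonneg ht p, ?_⟩
    have hyV := hxy.resolve_left h
    have hxy' : x ≤ y := by linarith
    have e : y ^ (2 - p) * y ^ p = y ^ 2 := by
      rw [← Real.rpow_add hy, ← Real.rpow_natCast]; norm_num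
    calc _ = Y * (y ^ (2 - p) * x ^ p) := by ring
      _ ≤ Y * (y ^ (2 - p) * y ^ p) := by gcongr
      _ = Y * y ^ 2 := by rw [e]
      _ ≤ Y * (4 * V) := by gcongr
      _ ≤ _ := by nlinarith [mul_nonneg hY hV]

/-! ### The one-sided estimate -/

lemma sub_bernsteinOp_le {n : ℕ} (hn : n ≠ 0) {lam : ℝ} (hl0 : 0 ≤ lam) (hl2 : lam < 2)
    {f : ℝ → ℝ} (hf : ContinuousOn f I01) {x : ℝ} (hx : x ∈ Set.Ioo (0 : ℝ) 1) {h W y : ℝ}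
    (hh : 0 < h) (hW : 0 < W) (hy : 0 < y)
    (hy0 : y ≤ 4 * x ∨ y ^ 2 ≤ 4 * (x * (1 - x) / n))
    (hy1 : y ≤ 4 * (1 - x) ∨ y ^ 2 ≤ 4 * (x * (1 - x) / n))
    (hmod : ∀ z ∈ I01, ∀ s, 0 < s → s ≤ h → z - s * phi z ^ lam ∈ I01 →
      z + s * phi z ^ lam ∈ I01 →
      |f (z - s * phi z ^ lam) - 2 * f z + f (z + s * phi z ^ lam)| ≤ W) :
    f x - bernsteinOp n f x ≤
      2112 / (2 - lam) * (1 + y ^ (-lam) * (x * (1 - x) / n) / h ^ 2) * W := by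
  obtain ⟨hx0, hx1⟩ := hx
  set V := x * (1 - x) / n with hV
  have hV0 : 0 ≤ V := by
    have : 0 ≤ 1 - x := by linarith
    positivity
  set p := (2 - lam) / 4 with hp
  have hp0 : 0 < p := by rw [hp]; linarith
  have hp1 : p ≤ 1 / 2 := by rw [hp]; linarith
  have hlp : p + lam ≤ 2 := by rw [hp]; linarith
  set K := 2 * W / (p / 8 * h ^ 2) with hK
  have hKpos : 0 < K := by positivity
  have hphi : ∀ z ∈ Set.Ioo (0 : ℝ) 1, 0 < phi z ^ lam := fun z hz =>
    Real.rpow_pos_of_pos (Real.sqrt_pos.2 (mul_pos hz.1 (by linarith [hz.2]))) _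
  have hpc : Continuous (barrier lam p y) := continuous_barrier hp0
  obtain ⟨l, hl⟩ := exists_approx_supporting_line (W := W)
    (F := fun t => f t + K * barrier lam p y t) (D := fun z => h * phi z ^ lam) hW.le
    (by fun_prop) (fun z hz => mul_pos hh (hphi z hz))
    (by
      intro z hz δ hδ0 hδ1 h0 h1
      have hpz := hphi z hz
      have hs : δ / phi z ^ lam * phi z ^ lam = δ := by field_simp
      have hm := hmod z ⟨hz.1.le, hz.2.le⟩ (δ / phi z ^ lam) (by positivity)
        (by rwa [div_le_iff₀ hpz]) (by rw [hs]; exact ⟨h0, by linarith [hz.2]⟩)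
        (by rw [hs]; exact ⟨by linarith [hz.1], h1⟩)
      rw [hs] at hm
      have hb := barrier_second_diff (lam := lam) hp0.le hp1 hy hδ0.le h0 h1 hz.1 hz.2
      have hb0 : 0 ≤ (2 * y ^ (-lam) +
          y ^ (2 - p - lam) * (p / 2 * (z ^ (p - 2) + (1 - z) ^ (p - 2)))) * δ ^ 2 := by
        have := hz.1
        have : 0 < 1 - z := by linarith [hz.2]
        positivity
      have := mul_nonneg hKpos.le (hb0.trans hb)
      linarith [neg_abs_le (f (z - δ) - 2 * f z + f (z + δ))])
    (by
      intro z hz h0 h1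
      have hpz := hphi z hz
      have hs := mul_pos hh hpz
      have hm := hmod z ⟨hz.1.le, hz.2.le⟩ h hh le_rfl ⟨h0, by linarith [hz.2]⟩
        ⟨by linarith [hz.1], h1⟩
      have hb := barrier_second_diff_phi hl0 hl2.le hp0.le hp1 hlp hy hz.1 hz.2 hh h0 h1
      have h3 := mul_le_mul_of_nonneg_left hb hKpos.le
      have h4 : K * (p / 8 * h ^ 2) = 2 * W := by rw [hK]; field_simp
      linarith [neg_abs_le (f (z - h * phi z ^ lam) - 2 * f z + f (z + h * phi z ^ lam))])
    ⟨hx0, hx1⟩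
  have hYy : y ^ (2 - p - lam) = y ^ (-lam) * y ^ (2 - p) := by
    rw [← Real.rpow_add hy]; ring_nf
  have hYnn : 0 ≤ y ^ (-lam) := Real.rpow_nonneg hy.le _
  obtain ⟨A₀, l₀, q₀, hq₀, hb₀⟩ := exists_quadratic_minorant_rpow hp0.le (by linarith) hx0 hy hV0
    hy0 hYnn
  obtain ⟨A₁, l₁, q₁, hq₁, hb₁⟩ := exists_quadratic_minorant_rpow (x := 1 - x) hp0.le
    (by linarith) (by linarith) hy hV0 hy1 hYnn
  rw [← hYy] at hb₀ hb₁
  set Y := y ^ (2 - p - lam) with hY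
  have hY0 : 0 ≤ Y := Real.rpow_nonneg hy.le _
  set B := y ^ (-lam) with hB
  have hbern := le_bernsteinOp_of_quadratic_le hn (x := x) ⟨hx0.le, hx1.le⟩ (g := f)
    (A := f x - W - K * (Y * (x ^ p - A₀)) - K * (Y * ((1 - x) ^ p - A₁)))
    (l := l - K * (B * (2 * x)) + K * (Y * l₀) - K * (Y * l₁))
    (q := -(K * B) - K * (Y * q₀) - K * (Y * q₁))
    (by
      intro t ht
      have h1 := hl t ht
      have h2 := mul_le_mul_of_nonneg_left (hq₀ t ht.1) (mul_nonneg hKpos.le hY0)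
      have h3 := mul_le_mul_of_nonneg_left (hq₁ (1 - t) (by linarith [ht.2]))
        (mul_nonneg hKpos.le hY0)
      simp only [barrier, ← hY, ← hB] at h1
      linarith)
  have h₀ := mul_le_mul_of_nonneg_left hb₀ hKpos.le
  have h₁ := mul_le_mul_of_nonneg_left hb₁ hKpos.le
  have hmain : f x - bernsteinOp n f x ≤ W + K * (33 * (B * V)) := by
    rw [← hV] at hbern
    linarith
  refine hmain.trans ?_
  have hlam : 0 < 2 - lam := by linarith
  have hKe : K * (33 * (B * V)) = 2112 / (2 - lam) * (B * V / h ^ 2) * W := by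
    rw [hK, hp]; field_simp; ring
  have hge : 1 ≤ 2112 / (2 - lam) := by rw [one_le_div hlam]; linarith
  rw [hKe]
  nlinarith

/-! ### The modulus of smoothness -/

lemma omega2_nonneg (ψ f : ℝ → ℝ) (t : ℝ) : 0 ≤ omega2 ψ f t := by
  refine Real.sSup_nonneg ?_
  rintro _ ⟨s, x, -, -, -, rfl⟩
  exact abs_nonneg _

lemma centralDiff_two {δ x : ℝ} (f : ℝ → ℝ) (h0 : x - δ ∈ I01) (h1 : x + δ ∈ I01) :
    centralDiff 2 δ f x = f (x - δ) - 2 * f x + f (x + δ) := by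
  have e : ((2 : ℕ) : ℝ) * δ / 2 = δ := by push_cast; ring
  have e1 : x - δ + δ = x := by ring
  have e2 : x - δ + 2 * δ = x + δ := by ring
  rw [centralDiff, e, if_pos ⟨h0, h1⟩]
  simp [Finset.sum_range_succ, e1, e2]
  ring

lemma second_diff_le_omega2 {ψ f : ℝ → ℝ} (hf : ContinuousOn f I01) {h s z : ℝ} (hs : 0 < s)
    (hsh : s ≤ h) (hz : z ∈ I01) (h0 : z - s * ψ z ∈ I01) (h1 : z + s * ψ z ∈ I01) :
    |f (z - s * ψ z) - 2 * f z + f (z + s * ψ z)| ≤ omega2 ψ f h := by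
  rw [← centralDiff_two f h0 h1]
  refine le_csSup ?_ ⟨s, z, hs, hsh, hz, rfl⟩
  obtain ⟨M, hM⟩ := isCompact_Icc.exists_bound_of_continuousOn hf
  have hM0 : 0 ≤ M := (norm_nonneg _).trans (hM 0 ⟨le_rfl, zero_le_one⟩)
  refine ⟨4 * M, ?_⟩
  rintro _ ⟨s, x, -, -, hx, rfl⟩
  by_cases hc : x - s * ψ x ∈ I01 ∧ x + s * ψ x ∈ I01
  · rw [centralDiff_two f hc.1 hc.2]
    have b1 := abs_le.1 (hM _ hc.1)
    have b2 := abs_le.1 (hM _ hx)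
    have b3 := abs_le.1 (hM _ hc.2)
    exact abs_le.2 ⟨by linarith, by linarith⟩
  · have e : ((2 : ℕ) : ℝ) * (s * ψ x) / 2 = s * ψ x := by push_cast; ring
    rw [centralDiff, e, if_neg hc, abs_zero]
    positivity

/-! ### The two-sided estimate -/

lemma abs_sub_bernsteinOp_le {n : ℕ} (hn : n ≠ 0) {lam : ℝ} (hl0 : 0 ≤ lam) (hl2 : lam < 2)
    {f : ℝ → ℝ} (hf : ContinuousOn f I01) {x : ℝ} (hx : x ∈ Set.Ioo (0 : ℝ) 1) {h : ℝ}
    (hh : 0 < h) :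
    |f x - bernsteinOp n f x| ≤
      2112 / (2 - lam) * (1 + (phi x * (phi x + (n : ℝ) ^ (-(1 / 2 : ℝ)))) ^ (-lam) *
        (x * (1 - x) / n) / h ^ 2) * omega2 (fun y => phi y ^ lam) f h := by
  obtain ⟨hx0, hx1⟩ := hx
  have hn' : (0 : ℝ) < n := by exact_mod_cast Nat.pos_of_ne_zero hn
  have hx1' : 0 < 1 - x := by linarith
  have hphi : 0 < phi x := Real.sqrt_pos.2 (mul_pos hx0 hx1')
  have hphi2 : phi x ^ 2 = x * (1 - x) := Real.sq_sqrt (mul_pos hx0 hx1').le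
  set N := (n : ℝ) ^ (-(1 / 2 : ℝ)) with hN
  have hN0 : 0 < N := Real.rpow_pos_of_pos hn' _
  have hN2 : N ^ 2 = 1 / n := by
    rw [hN, ← Real.rpow_natCast, ← Real.rpow_mul hn'.le]
    norm_num [Real.rpow_neg_one]
  set y := phi x * (phi x + N) with hy
  have hy0 : 0 < y := by positivity
  have hV : x * (1 - x) / n = (phi x * N) ^ 2 := by rw [mul_pow, hphi2, hN2]; ring
  have hcase : y ≤ 2 * phi x ^ 2 ∨ y ^ 2 ≤ 4 * (x * (1 - x) / n) := by
    rcases le_total N (phi x) with hle | hle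
    · left; nlinarith
    · right
      have : y ≤ 2 * (phi x * N) := by nlinarith
      rw [hV]
      nlinarith
  rw [hphi2] at hcase
  have hlam : 0 < 2 - lam := by linarith
  have hyx : y ≤ 4 * x ∨ y ^ 2 ≤ 4 * (x * (1 - x) / n) := hcase.imp_left fun h => by nlinarith
  have hyx' : y ≤ 4 * (1 - x) ∨ y ^ 2 ≤ 4 * (x * (1 - x) / n) :=
    hcase.imp_left fun h => by nlinarith
  set C := 2112 / (2 - lam) * (1 + y ^ (-lam) * (x * (1 - x) / n) / h ^ 2) with hC
  have hC0 : 0 < C := by positivity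
  have hbound : ∀ w, omega2 (fun y => phi y ^ lam) f h < w → |f x - bernsteinOp n f x| ≤ C * w := by
    intro w hw
    have hw0 : 0 < w := (omega2_nonneg _ _ _).trans_lt hw
    have hmod : ∀ z ∈ I01, ∀ s, 0 < s → s ≤ h → z - s * phi z ^ lam ∈ I01 →
        z + s * phi z ^ lam ∈ I01 →
        |f (z - s * phi z ^ lam) - 2 * f z + f (z + s * phi z ^ lam)| ≤ w :=
      fun z hz s hs hsh h0 h1 =>
        (second_diff_le_omega2 (ψ := fun y => phi y ^ lam) hf hs hsh hz h0 h1).trans hw.le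
    have hup := sub_bernsteinOp_le hn hl0 hl2 hf ⟨hx0, hx1⟩ hh hw0 hy0 hyx hyx' hmod
    have hdown := sub_bernsteinOp_le hn hl0 hl2 (f := fun t => -f t) hf.neg ⟨hx0, hx1⟩ hh hw0 hy0
      hyx hyx' (fun z hz s hs hsh h0 h1 => by
        rw [← abs_neg]
        refine le_trans (le_of_eq ?_) (hmod z hz s hs hsh h0 h1)
        ring_nf)
    rw [bernsteinOp_neg] at hdown
    exact abs_le.2 ⟨by linarith, hup⟩
  rw [← div_le_iff₀' hC0]
  refine le_of_forall_gt_imp_ge_of_dense fun w hw => ?_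
  rw [div_le_iff₀' hC0]
  exact hbound w hw


theorem statement6 :
    ∃ c₀ : ℝ, 0 < c₀ ∧ ∃ c : ℝ → ℝ,
      (∀ lam ∈ Set.Ico (0 : ℝ) 2, 0 < c lam) ∧
      ∀ n : ℕ, 1 ≤ n → ∀ lam ∈ Set.Ico (0 : ℝ) 2,
        ∀ f, ContinuousOn f I01 → ∀ x ∈ I01,
          (∀ h : ℝ, 0 < h → h ≤ c₀ →
            |f x - bernsteinOp n f x| ≤
              c lam * (1 + phi x ^ ((2 : ℝ) - lam) /
                  (h ^ 2 * (n : ℝ) * (phi x + (n : ℝ) ^ (-(1 / 2 : ℝ))) ^ lam)) *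
                omega2 (fun y => phi y ^ lam) f h) ∧
          |f x - bernsteinOp n f x| ≤
            c lam * omega2 (fun y => phi y ^ lam) f
              ((n : ℝ) ^ (-(1 / 2 : ℝ)) * phi x ^ ((1 : ℝ) - lam / 2) *
                (phi x + (n : ℝ) ^ (-(1 / 2 : ℝ))) ^ (-(lam / 2))) := by
  refine ⟨1, one_pos, fun lam => 4224 / (2 - lam), fun lam hlam => ?_, ?_⟩
  · have : 0 < 2 - lam := by linarith [hlam.2]
    positivity
  intro n hn lam hlam f hf x hx
  have hn0 : n ≠ 0 := Nat.one_le_iff_ne_zero.1 hn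
  have hn' : (0 : ℝ) < n := by exact_mod_cast hn
  have hl0 : 0 ≤ lam := hlam.1
  have hlam' : 0 < 2 - lam := by linarith [hlam.2]
  set N := (n : ℝ) ^ (-(1 / 2 : ℝ)) with hN
  have hN0 : 0 < N := Real.rpow_pos_of_pos hn' _
  have hN2 : N ^ 2 = 1 / n := by
    rw [hN, ← Real.rpow_natCast, ← Real.rpow_mul hn'.le]
    norm_num [Real.rpow_neg_one]
  have hphi0 : 0 ≤ phi x := Real.sqrt_nonneg _
  have hω := omega2_nonneg (fun y => phi y ^ lam) f
  by_cases hend : x = 0 ∨ x = 1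
  · have hzero : |f x - bernsteinOp n f x| = 0 := by
      rcases hend with rfl | rfl
      · simp [bernsteinOp_zero]
      · simp [bernsteinOp_one hn0]
    rw [hzero]
    refine ⟨fun h hh _ => mul_nonneg ?_ (hω _), mul_nonneg ?_ (hω _)⟩ <;> positivity
  · push Not at hend
    have hx' : x ∈ Set.Ioo (0 : ℝ) 1 :=
      ⟨lt_of_le_of_ne hx.1 hend.1.symm, lt_of_le_of_ne hx.2 hend.2⟩
    have hxx : 0 < x * (1 - x) := mul_pos hx'.1 (by linarith [hx'.2])
    have hphi : 0 < phi x := Real.sqrt_pos.2 hxx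
    have hphi2 : phi x ^ 2 = x * (1 - x) := Real.sq_sqrt hxx.le
    have hS : 0 < phi x + N := by positivity
    have hT : (phi x * (phi x + N)) ^ (-lam) * (x * (1 - x) / n) =
        phi x ^ (2 - lam) / (n * (phi x + N) ^ lam) := by
      rw [Real.mul_rpow hphi.le hS.le, Real.rpow_neg hphi.le, Real.rpow_neg hS.le,
        Real.rpow_sub hphi, Real.rpow_two, hphi2]
      field_simp
    refine ⟨fun h hh _ => ?_, ?_⟩
    · refine (abs_sub_bernsteinOp_le hn0 hl0 hlam.2 hf hx' hh).trans ?_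
      rw [hT]
      refine mul_le_mul_of_nonneg_right ?_ (hω h)
      rw [div_div, show n * (phi x + N) ^ lam * h ^ 2 = h ^ 2 * n * (phi x + N) ^ lam by ring]
      gcongr
      exact div_le_div_of_nonneg_right (by norm_num) hlam'.le
    · set H := N * phi x ^ (1 - lam / 2) * (phi x + N) ^ (-(lam / 2)) with hH
      have hH0 : 0 < H := by positivity
      have hsq : ∀ a : ℝ, 0 < a → ∀ r : ℝ, (a ^ r) ^ 2 = a ^ (r * 2) := fun a ha r => by
        rw [Real.rpow_mul ha.le, Real.rpow_two]
      have hH2 : H ^ 2 = phi x ^ (2 - lam) / (n * (phi x + N) ^ lam) := by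
        rw [hH, mul_pow, mul_pow, hN2, hsq _ hphi, hsq _ hS,
          show (1 - lam / 2) * 2 = 2 - lam by ring, show -(lam / 2) * 2 = -lam by ring,
          Real.rpow_neg hS.le]
        field_simp
      refine (abs_sub_bernsteinOp_le hn0 hl0 hlam.2 hf hx' hH0).trans (le_of_eq ?_)
      rw [hT, ← hH2, div_self (by positivity)]
      ring
end
end

section
/- The estimate E_n(f) ≤ c ω₂^{φ²}(f,1) cannot hold with a constant c independent of f: for every n ∈ ℕ and every A > 0 there exists f ∈ C[0,1] with ω₂^{φ²}(f,1) ≤ 1 and E_n(f) > A. Equivalently, for each n ∈ ℕ, sup{ E_n(f) : f ∈ C[0,1], ω₂^{φ²}(f,1) ≤ 1 } = ∞. -/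
noncomputable section

open Set Finset
open scoped Classical

/-- The sup-norm over `[0,1]`. -/
def supNormI (f : ℝ → ℝ) : ℝ := sSup {v : ℝ | ∃ x ∈ I01, v = |f x|}

/-- `E_n(f)`: the degree of best uniform polynomial approximation of `f` on `[0,1]`. -/
def bestApprox (n : ℕ) (f : ℝ → ℝ) : ℝ :=
  sInf {v : ℝ | ∃ p : Polynomial ℝ, p.natDegree ≤ n ∧
    v = supNormI (fun x => f x - p.eval x)}

/-- A polynomial of degree at most `n` that is bounded on an infinite set is bounded at any given
point, with a constant depending only on `n`, the set and the point. -/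
theorem exists_abs_eval_le_of_infinite (n : ℕ) {S : Set ℝ} (hS : S.Infinite) (c : ℝ) :
    ∃ C : ℝ, ∀ (p : Polynomial ℝ) (M : ℝ), p.natDegree ≤ n →
      (∀ x ∈ S, |p.eval x| ≤ M) → |p.eval c| ≤ C * M := by
  obtain ⟨s, hs, hcard⟩ := hS.exists_subset_card_eq (n + 1)
  refine ⟨∑ i ∈ s, |(Lagrange.basis s id i).eval c|, fun p M hp hM => ?_⟩
  have hdeg : p.degree < (s.card : WithBot ℕ) := by
    rw [hcard]
    exact lt_of_le_of_lt (Polynomial.degree_le_of_natDegree_le hp)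
      (by exact_mod_cast Nat.lt_succ_self n)
  have hp_eq := Lagrange.eq_interpolate (s := s) (v := id) (Function.injective_id.injOn) hdeg
  rw [hp_eq, Lagrange.interpolate_apply, Polynomial.eval_finsetSum, Finset.sum_mul]
  refine (Finset.abs_sum_le_sum_abs _ _).trans (Finset.sum_le_sum fun i hi => ?_)
  rw [Polynomial.eval_mul, Polynomial.eval_C, abs_mul, mul_comm]
  exact mul_le_mul_of_nonneg_left (hM i (hs hi)) (abs_nonneg _)

/-- The double logarithm `log (1 - log x)`, cut off below at `ε`. -/
def truncLogLog (ε x : ℝ) : ℝ := Real.log (1 - Real.log (max x ε))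

theorem one_le_one_sub_log {a : ℝ} (ha : 0 < a) (ha1 : a ≤ 1) : 1 ≤ 1 - Real.log a := by
  linarith [Real.log_nonpos ha.le ha1]

theorem log_one_sub_log_anti {a b : ℝ} (ha : 0 < a) (hab : a ≤ b) (hb : b ≤ 1) :
    Real.log (1 - Real.log b) ≤ Real.log (1 - Real.log a) := by
  have h1 := one_le_one_sub_log (ha.trans_le hab) hb
  have h2 := Real.log_le_log ha hab
  exact Real.log_le_log (by linarith) (by linarith)

theorem log_two_le_one : Real.log 2 ≤ 1 := by
  linarith [Real.log_le_sub_one_of_pos (zero_lt_two (α := ℝ))]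

theorem log_one_sub_log_le_add_one {a b : ℝ} (ha : 0 < a) (ha1 : a ≤ 1) (hb : 0 < b) (hb1 : b ≤ 1)
    (h : b ^ 2 ≤ 2 * a) : Real.log (1 - Real.log a) ≤ Real.log (1 - Real.log b) + 1 := by
  have h1 := one_le_one_sub_log ha ha1
  have h2 := one_le_one_sub_log hb hb1
  have h3 := Real.log_le_log (by positivity) h
  rw [Real.log_pow, Real.log_mul two_ne_zero ha.ne'] at h3
  push_cast at h3
  have h4 : Real.log (1 - Real.log a) ≤ Real.log (2 * (1 - Real.log b)) :=
    Real.log_le_log (by linarith) (by linarith [log_two_le_one])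
  rw [Real.log_mul two_ne_zero (by linarith)] at h4
  linarith [log_two_le_one]

theorem continuousOn_truncLogLog {ε : ℝ} (hε : 0 < ε) (hε1 : ε ≤ 1) :
    ContinuousOn (truncLogLog ε) I01 := by
  have hm : ∀ x : ℝ, 0 < max x ε := fun x => lt_max_of_lt_right hε
  refine ContinuousOn.log (continuousOn_const.sub
    (ContinuousOn.log (by fun_prop) fun x _ => (hm x).ne')) fun x hx => ?_
  linarith [one_le_one_sub_log (hm x) (max_le hx.2 hε1)]

theorem abs_secondDiff_truncLogLog_le {ε : ℝ} (hε : 0 < ε) (hε1 : ε ≤ 1) {x δ : ℝ}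
    (hδ : 0 ≤ δ) (hδx : δ ≤ x * (1 - x)) (h0 : 0 ≤ x - δ) (h1 : x + δ ≤ 1) :
    |truncLogLog ε (x - δ) - 2 * truncLogLog ε x + truncLogLog ε (x + δ)| ≤ 1 := by
  have hm : ∀ y : ℝ, 0 < max y ε := fun y => lt_max_of_lt_right hε
  have hm1 : ∀ y : ℝ, y ≤ 1 → max y ε ≤ 1 := fun y hy => max_le hy hε1
  have hl := hm1 (x - δ) (by linarith)
  have hc := hm1 x (by linarith)
  have hr := hm1 (x + δ) h1
  have hlc : max (x - δ) ε ≤ max x ε := max_le_max_right _ (by linarith)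
  have hcr : max x ε ≤ max (x + δ) ε := max_le_max_right _ (by linarith)
  have hsq : max x ε ^ 2 ≤ 2 * max (x - δ) ε := by
    rcases max_cases x ε with h | h <;>
      nlinarith [le_max_left (x - δ) ε, le_max_right (x - δ) ε]
  have hmr : max (x + δ) ε ≤ max x ε * (2 - max x ε) := by
    have := le_max_left x ε
    have := le_max_right x ε
    exact max_le (by nlinarith) (by nlinarith)
  have hsq' : max (x + δ) ε ^ 2 ≤ 2 * max x ε := by
    have := hm x
    have := hm (x + δ)
    nlinarith
  have e1 := log_one_sub_log_anti (hm _) hlc hc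
  have e2 := log_one_sub_log_anti (hm _) hcr hr
  have e3 := log_one_sub_log_le_add_one (hm _) hl (hm _) hc hsq
  have e4 := log_one_sub_log_le_add_one (hm _) hc (hm _) hr hsq'
  unfold truncLogLog
  rw [abs_le]
  constructor <;> linarith

theorem omega2_truncLogLog_le {ε : ℝ} (hε : 0 < ε) (hε1 : ε ≤ 1) :
    omega2 (fun y => phi y ^ 2) (truncLogLog ε) 1 ≤ 1 := by
  refine Real.sSup_le ?_ zero_le_one
  rintro v ⟨s, x, hs, hs1, hx, rfl⟩
  have hφ0 : 0 ≤ x * (1 - x) := mul_nonneg hx.1 (by linarith [hx.2])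
  have hφ : phi x ^ 2 = x * (1 - x) := Real.sq_sqrt hφ0
  unfold centralDiff
  split_ifs with h
  · obtain ⟨⟨hl, -⟩, ⟨-, hr⟩⟩ := h
    simp only [hφ] at hl hr ⊢
    push_cast at hl hr
    convert abs_secondDiff_truncLogLog_le hε hε1 (x := x) (δ := s * (x * (1 - x)))
      (by positivity) (by nlinarith) (by linarith) (by linarith) using 2
    simp only [Finset.sum_range_succ, Finset.sum_range_zero]
    norm_num
    ring_nf
  · simp

theorem abs_truncLogLog_le_one {ε x : ℝ} (hε1 : ε ≤ 1) (hx : x ∈ Set.Icc (1 / 2 : ℝ) 1) :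
    |truncLogLog ε x| ≤ 1 := by
  have hm : 1 / 2 ≤ max x ε := le_max_of_le_left hx.1
  have h1 := one_le_one_sub_log (by linarith) (max_le hx.2 hε1)
  have h2 := Real.log_le_log (by norm_num) hm
  rw [one_div, Real.log_inv] at h2
  have h3 := log_two_le_one
  have h4 := Real.log_le_sub_one_of_pos (x := 1 - Real.log (max x ε)) (by linarith)
  unfold truncLogLog
  rw [abs_of_nonneg (Real.log_nonneg h1)]
  linarith

theorem abs_le_supNormI {f : ℝ → ℝ} (hf : ContinuousOn f I01) {x : ℝ} (hx : x ∈ I01) :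
    |f x| ≤ supNormI f := by
  refine le_csSup ?_ ⟨x, hx, rfl⟩
  obtain ⟨C, hC⟩ := (isCompact_Icc : IsCompact I01).exists_bound_of_continuousOn hf
  refine ⟨C, ?_⟩
  rintro v ⟨y, hy, rfl⟩
  exact hC y hy

theorem statement7 (n : ℕ) (A : ℝ) (hA : 0 < A) :
    ∃ f : ℝ → ℝ, ContinuousOn f I01 ∧
      omega2 (fun y => phi y ^ 2) f 1 ≤ 1 ∧ A < bestApprox n f := by
  obtain ⟨C, hC⟩ := exists_abs_eval_le_of_infinite n
    (Set.Icc_infinite (by norm_num : (1 / 2 : ℝ) < 1)) 0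
  set B := C * (A + 2) + (A + 1) with hB
  have hε : 0 < Real.exp (-Real.exp B) := Real.exp_pos _
  have hε1 : Real.exp (-Real.exp B) ≤ 1 :=
    Real.exp_le_one_iff.2 (neg_nonpos.2 (Real.exp_pos B).le)
  have hcont := continuousOn_truncLogLog hε hε1
  have hzero : B < truncLogLog (Real.exp (-Real.exp B)) 0 := by
    rw [truncLogLog, max_eq_right hε.le, Real.log_exp]
    exact (Real.lt_log_iff_exp_lt (by linarith [Real.exp_pos B])).2 (by linarith)
  refine ⟨_, hcont, omega2_truncLogLog_le hε hε1, ?_⟩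
  refine (lt_add_one A).trans_le (le_csInf ⟨_, 0, by simp, rfl⟩ ?_)
  rintro v ⟨p, hp, rfl⟩
  by_contra! hlt
  have hdist : ∀ x ∈ I01, -(A + 1) ≤ truncLogLog (Real.exp (-Real.exp B)) x - p.eval x ∧
      truncLogLog (Real.exp (-Real.exp B)) x - p.eval x ≤ A + 1 := fun x hx =>
    abs_le.1 ((abs_le_supNormI (hcont.sub p.continuous.continuousOn) hx).trans hlt.le)
  have hp0 := hC p (A + 2) hp fun x hx => by
    have h1 := hdist x ⟨by linarith [hx.1], hx.2⟩
    have h2 := abs_le.1 (abs_truncLogLog_le_one hε1 hx)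
    exact abs_le.2 ⟨by linarith [h1.2, h2.1], by linarith [h1.1, h2.2]⟩
  linarith [(hdist 0 ⟨le_rfl, zero_le_one⟩).2, le_abs_self (p.eval 0)]
end
end

section
/- If L : C[0,1] → C[0,1] is a positive linear operator preserving linear functions (L(e₀) = e₀ and L(e₁) = e₁), then L interpolates every continuous function at the endpoints: L(f,0) = f(0) and L(f,1) = f(1) for every f ∈ C[0,1]. -/
noncomputable section

open Set Finset
open scoped Classical

/-- A continuous function on `[0,1]` is dominated by `f x + ε + C |y - x|`. -/
lemma exists_le_add_mul_abs_sub {f : ℝ → ℝ} (hf : ContinuousOn f I01) {x : ℝ} (hx : x ∈ I01)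
    {ε : ℝ} (hε : 0 < ε) : ∃ C : ℝ, ∀ y ∈ I01, f y ≤ f x + ε + C * |y - x| := by
  obtain ⟨M, hM⟩ := (isCompact_Icc : IsCompact I01).bddAbove_image hf
  have hM' : ∀ y ∈ I01, f y ≤ M := fun y hy => hM (mem_image_of_mem f hy)
  obtain ⟨δ, hδ, h⟩ := Metric.continuousOn_iff.1 hf x hx ε hε
  have hC : 0 ≤ (M - f x) / δ := div_nonneg (sub_nonneg.2 (hM' x hx)) hδ.le
  refine ⟨(M - f x) / δ, fun y hy => ?_⟩
  rcases lt_or_ge |y - x| δ with hlt | hge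
  · have h1 := h y hy (by rwa [Real.dist_eq])
    rw [Real.dist_eq] at h1
    have h2 := le_abs_self (f y - f x)
    have h3 := mul_nonneg hC (abs_nonneg (y - x))
    linarith
  · have h1 := mul_le_mul_of_nonneg_left hge hC
    rw [div_mul_cancel₀ _ hδ.ne'] at h1
    linarith [hM' y hy]

/-- An affine majorant of `f` is a majorant of `L f`. -/
lemma PositiveLinearOp.apply_le_affine {L : (ℝ → ℝ) → (ℝ → ℝ)} (hL : PositiveLinearOp L)
    (hL0 : ∀ x ∈ I01, L (fun _ => 1) x = 1) (hL1 : ∀ x ∈ I01, L (fun y => y) x = x)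
    {f : ℝ → ℝ} (hf : ContinuousOn f I01) {c d : ℝ} (h : ∀ y ∈ I01, f y ≤ c + d * y)
    {x : ℝ} (hx : x ∈ I01) : L f x ≤ c + d * x := by
  obtain ⟨hadd, hsmul, -, hpos⟩ := hL
  have key := hpos (fun y => (c * 1 + d * y) + -1 * f y) (by fun_prop)
    (fun y hy => by linarith [h y hy]) x hx
  rw [hadd (fun y => c * 1 + d * y) (fun y => -1 * f y) (by fun_prop) (by fun_prop) x hx,
    hadd (fun _ => c * 1) (fun y => d * y) (by fun_prop) (by fun_prop) x hx,
    hsmul c (fun _ => 1) (by fun_prop) x hx, hsmul d (fun y => y) (by fun_prop) x hx,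
    hsmul (-1) f hf x hx, hL0 x hx, hL1 x hx] at key
  linarith

/-- If `|y - x|` agrees on `[0,1]` with an affine function of `y`, then `L f` interpolates `f`
at `x`. -/
lemma PositiveLinearOp.apply_eq_of_abs_sub_affine {L : (ℝ → ℝ) → (ℝ → ℝ)}
    (hL : PositiveLinearOp L)
    (hL0 : ∀ x ∈ I01, L (fun _ => 1) x = 1) (hL1 : ∀ x ∈ I01, L (fun y => y) x = x)
    {f : ℝ → ℝ} (hf : ContinuousOn f I01) {x : ℝ} (hx : x ∈ I01) {s : ℝ}
    (hs : ∀ y ∈ I01, |y - x| = s * (y - x)) : L f x = f x := by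
  have upper : ∀ g : ℝ → ℝ, ContinuousOn g I01 → L g x ≤ g x := by
    intro g hg
    refine le_of_forall_pos_le_add fun ε hε => ?_
    obtain ⟨C, hC⟩ := exists_le_add_mul_abs_sub hg hx hε
    have h := hL.apply_le_affine hL0 hL1 hg (c := g x + ε - C * s * x) (d := C * s)
      (fun y hy => by
        have h1 := hC y hy
        rw [hs y hy] at h1
        linarith) hx
    linarith
  refine le_antisymm (upper f hf) ?_
  have h := upper (fun y => -1 * f y) (by fun_prop)
  rw [hL.2.1 (-1) f hf x hx] at h
  linarith

theorem statement8 (L : (ℝ → ℝ) → (ℝ → ℝ)) (hL : PositiveLinearOp L)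
    (hL0 : ∀ x ∈ I01, L (fun _ => 1) x = 1)
    (hL1 : ∀ x ∈ I01, L (fun y => y) x = x) :
    ∀ f : ℝ → ℝ, ContinuousOn f I01 → L f 0 = f 0 ∧ L f 1 = f 1 := by
  intro f hf
  constructor
  · refine hL.apply_eq_of_abs_sub_affine hL0 hL1 hf (by simp [I01]) (s := 1) fun y hy => ?_
    rw [one_mul, abs_of_nonneg (sub_nonneg.2 hy.1)]
  · refine hL.apply_eq_of_abs_sub_affine hL0 hL1 hf (by simp [I01]) (s := -1) fun y hy => ?_
    rw [neg_one_mul, abs_of_nonpos (sub_nonpos.2 hy.2)]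
end
end

section
/- Let n ≥ 2 and let U_n be the genuine Bernstein–Durrmeyer (Goodman–Sharma) operator. Then U_n(e₀, x) = 1 for all x ∈ [0,1], and for every i ≥ 1 and all x ∈ [0,1]: U_n(e_i, x) = ((n−1)! · i! / (n+i−1)!) · Σ_{j=max{0, i−n}}^{i−1} C(i−1, j) C(n, i−j) x^{i−j}. In particular, U_n(e₁,x) = x and U_n(e₂,x) = x² + 2x(1−x)/(n+1). -/
noncomputable section

open Set Finset
open scoped Classical

/-- The genuine Bernstein–Durrmeyer (Goodman–Sharma) operator `U_n`. -/
def Uop (n : ℕ) (f : ℝ → ℝ) (x : ℝ) : ℝ :=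
  f 0 * (1 - x) ^ n + f 1 * x ^ n +
    ((n : ℝ) - 1) * ∑ k ∈ Finset.Icc 1 (n - 1),
      bern n k x * ∫ t in (0 : ℝ)..1, bern (n - 2) (k - 1) t * f t

/-- The Euler beta integral at natural exponents. -/
theorem integral_pow_mul_one_sub_pow (a b : ℕ) :
    ∫ t in (0 : ℝ)..1, t ^ a * (1 - t) ^ b =
      (a.factorial : ℝ) * b.factorial / (a + b + 1).factorial := by
  induction b generalizing a with
  | zero =>
    simp only [pow_zero, mul_one, integral_pow, Nat.factorial_succ, add_zero, Nat.factorial_zero]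
    have := a.factorial_ne_zero
    push_cast
    field_simp
    simp
  | succ b ih =>
    have hparts := intervalIntegral.integral_mul_deriv_eq_deriv_mul (a := (0 : ℝ)) (b := 1)
      (u := fun t : ℝ => (1 - t) ^ (b + 1)) (v := fun t : ℝ => t ^ (a + 1))
      (u' := fun t : ℝ => -((b + 1 : ℝ) * (1 - t) ^ b)) (v' := fun t : ℝ => (a + 1 : ℝ) * t ^ a)
      (fun t _ => by
        have h := HasDerivAt.fun_pow ((hasDerivAt_id' t).const_sub 1) (b + 1)
        simpa using h)
      (fun t _ => by simpa using hasDerivAt_pow (a + 1) t)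
      (Continuous.intervalIntegrable (by fun_prop) _ _)
      (Continuous.intervalIntegrable (by fun_prop) _ _)
    have hl : ∫ t in (0 : ℝ)..1, (1 - t) ^ (b + 1) * ((a + 1 : ℝ) * t ^ a) =
        (a + 1) * ∫ t in (0 : ℝ)..1, t ^ a * (1 - t) ^ (b + 1) := by
      rw [← intervalIntegral.integral_const_mul]
      congr 1; ext t; ring
    have hr : ∫ t in (0 : ℝ)..1, -((b + 1 : ℝ) * (1 - t) ^ b) * t ^ (a + 1) =
        -(b + 1) * ∫ t in (0 : ℝ)..1, t ^ (a + 1) * (1 - t) ^ b := by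
      rw [← intervalIntegral.integral_const_mul]
      congr 1; ext t; ring
    rw [hl, hr, ih (a + 1)] at hparts
    have ha : (a + 1 : ℝ) ≠ 0 := by positivity
    apply mul_left_cancel₀ ha
    rw [hparts, show a + 1 + b + 1 = a + (b + 1) + 1 by ring, Nat.factorial_succ a,
      Nat.factorial_succ b]
    push_cast
    simp
    ring

/-- Moments of the normalized Bernstein weights. -/
theorem bern_moment (l r i : ℕ) :
    ((l + r : ℕ) + 1 : ℝ) * ∫ t in (0 : ℝ)..1, bern (l + r) l t * t ^ i =
      ((l + r + 1).factorial : ℝ) * i.factorial / (l + r + 1 + i).factorial *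
        (l + i).choose i := by
  have h : ∫ t in (0 : ℝ)..1, bern (l + r) l t * t ^ i =
      (l + r).choose l * ∫ t in (0 : ℝ)..1, t ^ (l + i) * (1 - t) ^ r := by
    rw [← intervalIntegral.integral_const_mul]
    congr 1; ext t
    rw [bern, Nat.add_sub_cancel_left]; ring
  rw [h, integral_pow_mul_one_sub_pow, show l + i + r + 1 = l + r + 1 + i by ring,
    Nat.cast_add_choose, Nat.add_comm l i, Nat.cast_add_choose, Nat.factorial_succ (l + r)]
  have := Nat.factorial_ne_zero
  have hl : (l.factorial : ℝ) ≠ 0 := mod_cast this l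
  have hr : (r.factorial : ℝ) ≠ 0 := mod_cast this r
  have hi : (i.factorial : ℝ) ≠ 0 := mod_cast this i
  push_cast
  field_simp

/-- Factorial moments of the Bernstein basis. -/
theorem sum_choose_mul_bern (n m : ℕ) (x : ℝ) :
    ∑ k ∈ range (n + 1), (k.choose m : ℝ) * bern n k x = n.choose m * x ^ m := by
  rcases lt_or_ge n m with h | h
  · rw [Nat.choose_eq_zero_of_lt h, Finset.sum_eq_zero]
    · simp
    · intro k hk
      rw [Nat.choose_eq_zero_of_lt (by grind)]
      simp
  · obtain ⟨r, rfl⟩ := Nat.exists_eq_add_of_le h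
    rw [add_assoc, sum_range_add, Finset.sum_eq_zero, zero_add]
    · have hb := add_pow x (1 - x) r
      rw [add_sub_cancel, one_pow] at hb
      rw [← mul_one ((m + r).choose m * x ^ m : ℝ), hb, mul_sum]
      refine sum_congr rfl fun k _ => ?_
      have hc := Nat.choose_mul (n := m + r) (Nat.le_add_right m k)
      rw [Nat.add_sub_cancel_left, Nat.add_sub_cancel_left] at hc
      have hc' : ((m + r).choose (m + k) : ℝ) * (m + k).choose m =
        (m + r).choose m * r.choose k := mod_cast hc
      rw [bern, Nat.add_sub_add_left, pow_add]
      linear_combination (x ^ m * x ^ k * (1 - x) ^ (r - k)) * hc'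
    · intro k hk
      rw [Nat.choose_eq_zero_of_lt (by grind)]
      simp

theorem Uop_pow (m i : ℕ) (x : ℝ) :
    Uop (m + 2) (fun t => t ^ i) x = (0 : ℝ) ^ i * bern (m + 2) 0 x + bern (m + 2) (m + 2) x +
      ((m + 1).factorial : ℝ) * i.factorial / (m + 1 + i).factorial *
        ∑ l ∈ range (m + 1), ((l + i).choose i : ℝ) * bern (m + 2) (l + 1) x := by
  have hI : Finset.Icc 1 (m + 1) = Finset.Ico 1 (m + 2) := by ext; simp; omega
  rw [Uop, show m + 2 - 1 = m + 1 by omega, hI, sum_Ico_eq_sum_range,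
    show m + 2 - 1 = m + 1 by omega, mul_sum, mul_sum]
  congr 1
  · simp [bern]
  · refine sum_congr rfl fun l hl => ?_
    obtain ⟨r, rfl⟩ := Nat.exists_eq_add_of_le (Nat.lt_succ_iff.mp (Finset.mem_range.mp hl))
    have := bern_moment l r i
    rw [show l + r + 2 - 2 = l + r by omega, show 1 + l - 1 = l by omega, Nat.add_comm 1 l]
    push_cast at this ⊢
    linear_combination (bern (l + r + 2) (l + 1) x) * this

theorem Uop_one (m : ℕ) (x : ℝ) : Uop (m + 2) (fun _ => 1) x = 1 := by
  have h := Uop_pow m 0 x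
  have hs := sum_choose_mul_bern (m + 2) 0 x
  rw [sum_range_succ, sum_range_succ'] at hs
  have hf : ((m + 1).factorial : ℝ) ≠ 0 := mod_cast Nat.factorial_ne_zero _
  simp [hf] at h hs
  linarith

theorem Uop_pow_succ (m s : ℕ) (x : ℝ) :
    Uop (m + 2) (fun t => t ^ (s + 1)) x =
      ((m + 1).factorial : ℝ) * (s + 1).factorial / (m + 2 + s).factorial *
        ∑ k ∈ range (m + 3), ((k + s).choose (s + 1) : ℝ) * bern (m + 2) k x := by
  rw [Uop_pow, sum_range_succ _ (m + 2), sum_range_succ' _ (m + 1), show m + 1 + (s + 1) = m + 2 + s by ring]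
  have hs : ∀ l, l + 1 + s = l + (s + 1) := fun l => by ring
  have hc : ((m + 2 + s).choose (s + 1) : ℝ) =
      (m + 2 + s).factorial / ((m + 1).factorial * (s + 1).factorial) := by
    rw [show m + 2 + s = (m + 1) + (s + 1) by ring, Nat.add_comm (m + 1), Nat.cast_add_choose,
      mul_comm ((s + 1).factorial : ℝ)]
  have h0 : ((m + 2 + s).factorial : ℝ) ≠ 0 := mod_cast Nat.factorial_ne_zero _
  have h1 : ((m + 1).factorial : ℝ) ≠ 0 := mod_cast Nat.factorial_ne_zero _
  have h2 : ((s + 1).factorial : ℝ) ≠ 0 := mod_cast Nat.factorial_ne_zero _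
  rw [hc, Nat.zero_add, Nat.choose_succ_self]
  simp only [hs]
  push_cast
  field_simp
  ring

theorem sum_rising_choose_mul_bern (n s : ℕ) (x : ℝ) :
    ∑ k ∈ range (n + 1), ((k + s).choose (s + 1) : ℝ) * bern n k x =
      ∑ j ∈ Finset.Icc (s + 1 - n) s,
        (s.choose j : ℝ) * (n.choose (s + 1 - j) : ℝ) * x ^ (s + 1 - j) := by
  have hv : ∀ k : ℕ, ((k + s).choose (s + 1) : ℝ) =
      ∑ j ∈ range (s + 2), (s.choose j : ℝ) * k.choose (s + 1 - j) := fun k => by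
    rw [Nat.add_comm k, Nat.add_choose_eq, Nat.sum_antidiagonal_eq_sum_range_succ_mk]
    push_cast
    rfl
  simp only [hv, sum_mul]
  rw [sum_comm]
  simp only [mul_assoc, ← mul_sum, sum_choose_mul_bern]
  symm
  apply sum_subset
  · intro j hj
    simp at hj ⊢
    omega
  · intro j hj hj'
    simp at hj hj'
    rcases lt_or_ge s j with h | h
    · rw [Nat.choose_eq_zero_of_lt h]; simp
    · rw [Nat.choose_eq_zero_of_lt (n := n) (by omega)]; simp

theorem statement9 (n : ℕ) (hn : 2 ≤ n) :
    (∀ x ∈ I01, Uop n (fun _ => 1) x = 1) ∧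
    (∀ i : ℕ, 1 ≤ i → ∀ x ∈ I01,
      Uop n (fun t => t ^ i) x =
        ((n - 1).factorial : ℝ) * (i.factorial : ℝ) / ((n + i - 1).factorial : ℝ) *
          ∑ j ∈ Finset.Icc (i - n) (i - 1),
            ((i - 1).choose j : ℝ) * (n.choose (i - j) : ℝ) * x ^ (i - j)) ∧
    (∀ x ∈ I01, Uop n (fun t => t) x = x) ∧
    (∀ x ∈ I01, Uop n (fun t => t ^ 2) x = x ^ 2 + 2 * x * (1 - x) / ((n : ℝ) + 1)) := by
  have hpow : ∀ i : ℕ, 1 ≤ i → ∀ x : ℝ,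
      Uop n (fun t => t ^ i) x =
        ((n - 1).factorial : ℝ) * (i.factorial : ℝ) / ((n + i - 1).factorial : ℝ) *
          ∑ j ∈ Finset.Icc (i - n) (i - 1),
            ((i - 1).choose j : ℝ) * (n.choose (i - j) : ℝ) * x ^ (i - j) := by
    intro i hi x
    obtain ⟨m, rfl⟩ := Nat.exists_eq_add_of_le' hn
    obtain ⟨s, rfl⟩ := Nat.exists_eq_add_of_le' hi
    rw [Uop_pow_succ, sum_rising_choose_mul_bern]
    rfl
  refine ⟨fun x _ => ?_, fun i hi x _ => hpow i hi x, fun x _ => ?_, fun x _ => ?_⟩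
  · obtain ⟨m, rfl⟩ := Nat.exists_eq_add_of_le' hn
    exact Uop_one m x
  · have h := hpow 1 le_rfl x
    simp only [pow_one] at h
    rw [h]
    obtain ⟨m, rfl⟩ := Nat.exists_eq_add_of_le' hn
    have hf : ((m + 1).factorial : ℝ) ≠ 0 := mod_cast Nat.factorial_ne_zero _
    rw [show 1 - (m + 2) = 0 by omega, show m + 2 + 1 - 1 = m + 1 + 1 by omega,
      Nat.factorial_succ (m + 1)]
    simp
    field_simp
    ring
  · rw [hpow 2 (by norm_num) x]
    obtain ⟨m, rfl⟩ := Nat.exists_eq_add_of_le' hn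
    have hf : ((m + 1).factorial : ℝ) ≠ 0 := mod_cast Nat.factorial_ne_zero _
    have hI : Finset.Icc (2 - (m + 2)) (2 - 1) = range 2 := by ext; simp
    rw [hI, show m + 2 + 2 - 1 = m + 1 + 1 + 1 by omega,
      Nat.factorial_succ (m + 1 + 1), Nat.factorial_succ (m + 1)]
    simp [sum_range_succ, Nat.cast_choose_two]
    field_simp
    ring
end
end

section
/- For every n ≥ 2, every f ∈ C[0,1] and every 0 < x < 1: U_n(f,x) = f(0)(1−x)^n + f(1)x^n + (n−1)(1−x)^n ∫₀^x D_{n−2}(f,y)/(1−y)^n dy + (n−1)x^n ∫_x^1 D_{n−2}(f,y)/y^n dy, where D_m is the Bernstein–Durrmeyer operator. -/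
noncomputable section

open Set Finset
open scoped Classical

/-- The (usual) Bernstein–Durrmeyer operator `D_m`. -/
def Dop (m : ℕ) (f : ℝ → ℝ) (x : ℝ) : ℝ :=
  ((m : ℝ) + 1) * ∑ k ∈ Finset.range (m + 1),
    bern m k x * ∫ t in (0 : ℝ)..1, bern m k t * f t

lemma bern_symm {m k : ℕ} (hk : k ≤ m) (y : ℝ) : bern m k y = bern m (m - k) (1 - y) := by
  simp only [bern, Nat.choose_symm hk, Nat.sub_sub_self hk, sub_sub_cancel]
  ring

lemma continuous_bern (m k : ℕ) : Continuous (bern m k) := by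
  unfold bern
  fun_prop

lemma intervalIntegrable_bern_div_one_sub_pow (m k n : ℕ) {x : ℝ} (hx0 : 0 ≤ x) (hx1 : x < 1) :
    IntervalIntegrable (fun y => bern m k y / (1 - y) ^ n) MeasureTheory.volume 0 x := by
  refine ContinuousOn.intervalIntegrable ?_
  rw [Set.uIcc_of_le hx0]
  refine (continuous_bern m k).continuousOn.div (by fun_prop) fun y hy => ?_
  exact pow_ne_zero _ (by linarith [hy.2])

lemma intervalIntegrable_bern_div_pow (m k n : ℕ) {x : ℝ} (hx0 : 0 < x) (hx1 : x ≤ 1) :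
    IntervalIntegrable (fun y => bern m k y / y ^ n) MeasureTheory.volume x 1 := by
  refine ContinuousOn.intervalIntegrable ?_
  rw [Set.uIcc_of_le hx1]
  refine (continuous_bern m k).continuousOn.div (by fun_prop) fun y hy => ?_
  exact pow_ne_zero _ (by linarith [hy.1])

lemma integral_bern_div_one_sub_pow {m k : ℕ} (hk : k ≤ m) {x : ℝ} (hx0 : 0 ≤ x) (hx1 : x < 1) :
    ∫ y in (0 : ℝ)..x, bern m k y / (1 - y) ^ (m + 2) =
      (m.choose k : ℝ) / (k + 1) * (x / (1 - x)) ^ (k + 1) := by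
  have hderiv : ∀ y ∈ Set.uIcc 0 x, HasDerivAt
      (fun y : ℝ => (m.choose k : ℝ) / (k + 1) * (y / (1 - y)) ^ (k + 1))
      (bern m k y / (1 - y) ^ (m + 2)) y := by
    intro y hy
    rw [Set.uIcc_of_le hx0] at hy
    have hy1 : 1 - y ≠ 0 := by linarith [hy.2]
    refine ((((hasDerivAt_id y).div ((hasDerivAt_id y).const_sub 1) hy1).pow (k + 1)).const_mul
      ((m.choose k : ℝ) / (k + 1))).congr_deriv ?_
    obtain ⟨j, rfl⟩ := Nat.exists_eq_add_of_le hk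
    have hk1 : (k : ℝ) + 1 ≠ 0 := by positivity
    simp only [bern, id, Nat.add_sub_cancel_left, Nat.add_sub_cancel, Nat.cast_add, Nat.cast_one,
      Pi.div_apply, div_pow]
    field_simp
    ring
  rw [intervalIntegral.integral_eq_sub_of_hasDerivAt hderiv
    (intervalIntegrable_bern_div_one_sub_pow m k (m + 2) hx0 hx1)]
  simp

lemma integral_bern_div_pow {m k : ℕ} (hk : k ≤ m) {x : ℝ} (hx0 : 0 < x) (hx1 : x ≤ 1) :
    ∫ y in x..(1 : ℝ), bern m k y / y ^ (m + 2) =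
      (m.choose k : ℝ) / ((m - k : ℕ) + 1) * ((1 - x) / x) ^ (m - k + 1) := by
  have h := intervalIntegral.integral_comp_sub_left (a := x) (b := 1)
    (fun z => bern m (m - k) z / (1 - z) ^ (m + 2)) 1
  simp only [← bern_symm hk, sub_sub_cancel, sub_self] at h
  rw [h, integral_bern_div_one_sub_pow (Nat.sub_le m k) (by linarith) (by linarith),
    Nat.choose_symm hk, sub_sub_cancel]

lemma choose_add_two_mul (k j : ℕ) :
    ((k + j + 2).choose (k + 1) : ℝ) * ((k + 1) * (j + 1)) =
      (k + j + 1) * (k + j + 2) * (k + j).choose k := by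
  have h1 := Nat.add_one_mul_choose_eq (k + j + 1) k
  have h2 := Nat.choose_mul_succ_eq (k + j) k
  rw [show k + j + 1 - k = j + 1 by omega] at h2
  have h1' : ((k : ℝ) + j + 1 + 1) * (k + j + 1).choose k = (k + j + 2).choose (k + 1) * (k + 1) := by
    exact_mod_cast h1
  have h2' : ((k + j).choose k : ℝ) * (k + j + 1) = (k + j + 1).choose k * (j + 1) := by
    exact_mod_cast h2
  linear_combination (-(j : ℝ) - 1) * h1' - ((k : ℝ) + j + 2) * h2'

lemma bern_add_two_succ {m k : ℕ} (hk : k ≤ m) {x : ℝ} (hx : x ∈ Set.Ioo (0 : ℝ) 1) :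
    bern (m + 2) (k + 1) x =
      ((m : ℝ) + 1) * ((1 - x) ^ (m + 2) * (∫ y in (0 : ℝ)..x, bern m k y / (1 - y) ^ (m + 2)) +
        x ^ (m + 2) * ∫ y in x..(1 : ℝ), bern m k y / y ^ (m + 2)) := by
  rw [integral_bern_div_one_sub_pow hk hx.1.le hx.2, integral_bern_div_pow hk hx.1 hx.2.le]
  obtain ⟨j, rfl⟩ := Nat.exists_eq_add_of_le hk
  have hx0 : x ≠ 0 := hx.1.ne'
  have hx1 : 1 - x ≠ 0 := by linarith [hx.2]
  have hk1 : (k : ℝ) + 1 ≠ 0 := by positivity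
  have hj1 : (j : ℝ) + 1 ≠ 0 := by positivity
  have hchoose : ((k + j + 2).choose (k + 1) : ℝ) =
      (k + j + 1) * (k + j + 2) * (k + j).choose k / ((k + 1) * (j + 1)) := by
    rw [eq_div_iff (by positivity), choose_add_two_mul]
  simp only [bern, Nat.add_sub_cancel_left, show k + j + 2 - (k + 1) = j + 1 by omega, hchoose,
    Nat.cast_add, div_pow]
  field_simp
  ring

lemma integral_Dop_mul (m : ℕ) (f w : ℝ → ℝ) (a b : ℝ)
    (hw : ∀ k, IntervalIntegrable (fun y => bern m k y / w y) MeasureTheory.volume a b) :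
    ∫ y in a..b, Dop m f y / w y =
      ((m : ℝ) + 1) * ∑ k ∈ Finset.range (m + 1),
        (∫ y in a..b, bern m k y / w y) * ∫ t in (0 : ℝ)..1, bern m k t * f t := by
  have h : ∀ y, Dop m f y / w y = ((m : ℝ) + 1) * ∑ k ∈ Finset.range (m + 1),
      bern m k y / w y * ∫ t in (0 : ℝ)..1, bern m k t * f t := by
    intro y
    simp only [Dop, mul_div_assoc, Finset.sum_div, div_mul_eq_mul_div]
  simp only [h]
  rw [intervalIntegral.integral_const_mul,
    intervalIntegral.integral_finsetSum fun k _ => (hw k).mul_const _]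
  simp only [intervalIntegral.integral_mul_const]

theorem statement10 (n : ℕ) (hn : 2 ≤ n) (f : ℝ → ℝ) (hf : ContinuousOn f I01)
    (x : ℝ) (hx : x ∈ Set.Ioo (0 : ℝ) 1) :
    Uop n f x = f 0 * (1 - x) ^ n + f 1 * x ^ n +
      ((n : ℝ) - 1) * (1 - x) ^ n * (∫ y in (0 : ℝ)..x, Dop (n - 2) f y / (1 - y) ^ n) +
      ((n : ℝ) - 1) * x ^ n * ∫ y in x..(1 : ℝ), Dop (n - 2) f y / y ^ n := by
  obtain ⟨m, rfl⟩ := Nat.exists_eq_add_of_le' hn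
  simp only [Nat.add_sub_cancel]
  rw [integral_Dop_mul m f (fun y => (1 - y) ^ (m + 2)) 0 x fun k =>
      intervalIntegrable_bern_div_one_sub_pow m k _ hx.1.le hx.2,
    integral_Dop_mul m f (fun y => y ^ (m + 2)) x 1 fun k =>
      intervalIntegrable_bern_div_pow m k _ hx.1 hx.2.le]
  have hsum : ∑ k ∈ Finset.Icc 1 (m + 1),
        bern (m + 2) k x * ∫ t in (0 : ℝ)..1, bern m (k - 1) t * f t =
      ∑ k ∈ Finset.range (m + 1),
        bern (m + 2) (k + 1) x * ∫ t in (0 : ℝ)..1, bern m k t * f t := by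
    rw [← Finset.Ico_add_one_right_eq_Icc, Finset.sum_Ico_eq_sum_range]
    simp [add_comm 1]
  rw [Uop, show m + 2 - 1 = m + 1 by omega, Nat.add_sub_cancel, hsum,
    add_assoc (f 0 * (1 - x) ^ (m + 2) + f 1 * x ^ (m + 2))]
  congr 1
  simp only [Finset.mul_sum]
  rw [← Finset.sum_add_distrib]
  refine Finset.sum_congr rfl fun k hk => ?_
  rw [bern_add_two_succ (Nat.lt_succ_iff.mp (Finset.mem_range.mp hk)) hx]
  ring
end
end

section
/- For each r ∈ ℕ and μ ∈ ℕ there exists a constant c > 0 depending only on r and μ such that for every n ∈ ℕ there exists a polynomial P_n of degree ≤ n satisfying: (a) P_n^{(ν)}(x) ≥ 0 for all x ∈ [0,1] and every 0 ≤ ν ≤ r; (b) ∫₀¹ P_n(x) dx = 1; and (c) 1 − ∫₀¹ x^μ P_n(x) dx ≤ c/n². Moreover, the same polynomial P_n (independent of μ) works for all μ ∈ ℕ simultaneously, with c = c(r,μ). -/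
noncomputable section

open Set Finset
open scoped Classical

open Polynomial in
theorem exists_antiderivative (q : ℝ[X]) :
    ∃ Q : ℝ[X], Q.natDegree ≤ q.natDegree + 1 ∧ derivative Q = q ∧ Q.eval 0 = 0 := by
  refine ⟨∑ i ∈ Finset.range (q.natDegree + 1), C (q.coeff i / (i + 1)) * X ^ (i + 1), ?_, ?_, ?_⟩
  · refine natDegree_sum_le_of_forall_le _ _ fun i hi => ?_
    exact (natDegree_C_mul_X_pow_le _ _).trans (by simpa using Finset.mem_range.1 hi)
  · rw [derivative_sum]
    conv_rhs => rw [q.as_sum_range_C_mul_X_pow]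
    refine Finset.sum_congr rfl fun i _ => ?_
    have h : (i : ℝ) + 1 ≠ 0 := by positivity
    rw [derivative_C_mul_X_pow]
    simp [div_mul_cancel₀ _ h]
  · simp [eval_finsetSum]

open Polynomial in
theorem eval_nonneg_of_derivative_nonneg {Q : ℝ[X]} (h0 : Q.eval 0 = 0)
    (h : ∀ x ∈ Set.Icc (0 : ℝ) 1, 0 ≤ (derivative Q).eval x) :
    ∀ x ∈ Set.Icc (0 : ℝ) 1, 0 ≤ Q.eval x := by
  intro x hx
  have h1 : ∫ t in (0 : ℝ)..x, (derivative Q).eval t = Q.eval x - Q.eval 0 :=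
    intervalIntegral.integral_eq_sub_of_hasDerivAt (fun t _ => Q.hasDerivAt t)
      ((derivative Q).continuous.intervalIntegrable _ _)
  have h2 : 0 ≤ ∫ t in (0 : ℝ)..x, (derivative Q).eval t :=
    intervalIntegral.integral_nonneg hx.1 fun t ht => h t ⟨ht.1, ht.2.trans hx.2⟩
  linarith

open Polynomial in
theorem integral_one_sub_pow_mul_derivative {Q : ℝ[X]} (h0 : Q.eval 0 = 0) (s : ℕ) :
    ∫ x in (0 : ℝ)..1, (1 - x) ^ (s + 1) * (derivative Q).eval x =
      (s + 1) * ∫ x in (0 : ℝ)..1, (1 - x) ^ s * Q.eval x := by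
  rw [intervalIntegral.integral_mul_deriv_eq_deriv_mul
    (u := fun x : ℝ => (1 - x) ^ (s + 1)) (v := fun x => Q.eval x)
    (u' := fun x : ℝ => -((s + 1) * (1 - x) ^ s)) (fun x _ => ?_) (fun x _ => Q.hasDerivAt x)
    (Continuous.intervalIntegrable (by fun_prop) _ _)
    ((derivative Q).continuous.intervalIntegrable _ _)]
  · rw [← intervalIntegral.integral_const_mul]
    simp [h0, mul_assoc]
  · have := ((hasDerivAt_id x).const_sub 1).pow (s + 1)
    refine (this.congr_deriv ?_).congr_of_eventuallyEq
      (Filter.Eventually.of_forall fun z => by simp)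
    simp

open Polynomial in
/-- The `r`-fold antiderivative vanishing at `0`. -/
theorem exists_iterated_antiderivative (q : ℝ[X]) (hq : ∀ x ∈ Set.Icc (0 : ℝ) 1, 0 ≤ q.eval x)
    (r : ℕ) :
    ∃ P : ℝ[X], P.natDegree ≤ q.natDegree + r ∧
      (∀ ν ≤ r, ∀ x ∈ Set.Icc (0 : ℝ) 1, 0 ≤ (derivative^[ν] P).eval x) ∧
      ∀ s : ℕ, ((s + r).factorial : ℝ) * ∫ x in (0 : ℝ)..1, (1 - x) ^ s * P.eval x =
        s.factorial * ∫ x in (0 : ℝ)..1, (1 - x) ^ (s + r) * q.eval x := by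
  induction r with
  | zero =>
    refine ⟨q, le_rfl, fun ν hν => ?_, fun s => rfl⟩
    obtain rfl : ν = 0 := by omega
    exact hq
  | succ r ih =>
    obtain ⟨P, hdeg, hpos, hmom⟩ := ih
    obtain ⟨Q, hQdeg, rfl, hQ0⟩ := exists_antiderivative P
    refine ⟨Q, by omega, ?_, fun s => ?_⟩
    · rintro (_ | ν) hν
      · exact eval_nonneg_of_derivative_nonneg hQ0 (hpos 0 (Nat.zero_le _))
      · exact hpos ν (by omega)
    · have h := hmom (s + 1)
      rw [integral_one_sub_pow_mul_derivative hQ0, Nat.factorial_succ s,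
        show s + 1 + r = s + (r + 1) by ring] at h
      have h1 : (s : ℝ) + 1 ≠ 0 := by positivity
      apply mul_left_cancel₀ h1
      push_cast at h
      linear_combination h

theorem abs_sin_natCast_mul_le (m : ℕ) (x : ℝ) : |Real.sin (m * x)| ≤ m * |Real.sin x| := by
  induction m with
  | zero => simp
  | succ m ih =>
    have h : Real.sin ((m + 1 : ℕ) * x) =
        Real.sin (m * x) * Real.cos x + Real.cos (m * x) * Real.sin x := by
      rw [← Real.sin_add]; congr 1; push_cast; ring
    rw [h]
    refine (abs_add_le _ _).trans ?_
    rw [abs_mul, abs_mul]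
    have h1 := mul_le_of_le_one_right (abs_nonneg (Real.sin (m * x))) (Real.abs_cos_le_one x)
    have h2 := mul_le_of_le_one_left (abs_nonneg (Real.sin x)) (Real.abs_cos_le_one (m * x))
    push_cast
    linarith

open Polynomial in
/-- The Fejér kernel in the algebraic variable `y = sin² φ`. -/
theorem exists_fejer_polynomial (m : ℕ) :
    ∃ K : ℝ[X], K.natDegree ≤ m - 1 ∧
      ∀ φ : ℝ, Real.sin φ ^ 2 * K.eval (Real.sin φ ^ 2) = Real.sin (m * φ) ^ 2 := by
  set L : ℝ[X] := C (1 / 2) * (1 - (Chebyshev.T ℝ m).comp (1 - C 2 * X)) with hL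
  have hlin : (1 - C 2 * X : ℝ[X]).natDegree ≤ 1 := by compute_degree
  have heval : ∀ φ : ℝ, L.eval (Real.sin φ ^ 2) = Real.sin (m * φ) ^ 2 := by
    intro φ
    have h1 : 1 - 2 * Real.sin φ ^ 2 = Real.cos (2 * φ) := by
      rw [Real.cos_two_mul']; linarith [Real.sin_sq_add_cos_sq φ]
    have h2 := Chebyshev.T_real_cos (2 * φ) m
    have h3 : ((m : ℤ) : ℝ) * (2 * φ) = 2 * (m * φ) := by push_cast; ring
    rw [h3, ← h1, Real.cos_two_mul'] at h2
    simp only [hL, eval_mul, eval_C, eval_sub, eval_one, eval_comp, eval_X, h2]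
    linarith [Real.sin_sq_add_cos_sq (m * φ)]
  refine ⟨L.divX, ?_, fun φ => ?_⟩
  · rw [natDegree_divX_eq_natDegree_tsub_one]
    refine Nat.sub_le_sub_right ?_ 1
    refine (natDegree_C_mul_le _ _).trans ((natDegree_sub_le _ _).trans ?_)
    rw [natDegree_one, Nat.zero_max]
    refine natDegree_comp_le.trans ?_
    rw [Chebyshev.natDegree_T, Int.natAbs_natCast]
    simpa using Nat.mul_le_mul_left m hlin
  · have h0 : L.coeff 0 = 0 := by
      rw [coeff_zero_eq_eval_zero]
      simpa using heval 0
    have h := congrArg (eval (Real.sin φ ^ 2)) L.divX_mul_X_add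
    rw [heval, h0] at h
    simpa [mul_comm] using h

open Polynomial in
theorem exists_peaked_polynomial (m : ℕ) (hm : 1 ≤ m) :
    ∃ K : ℝ[X], K.natDegree ≤ m - 1 ∧
      ∀ y ∈ Set.Ioo (0 : ℝ) 1, 0 ≤ K.eval y ∧ y * K.eval y ≤ 1 ∧ K.eval y ≤ (m : ℝ) ^ 2 ∧
        (y ≤ 1 / (m : ℝ) ^ 2 → (m : ℝ) ^ 2 / 4 ≤ K.eval y) := by
  obtain ⟨K, hdeg, hK⟩ := exists_fejer_polynomial m
  refine ⟨K, hdeg, fun y hy => ?_⟩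
  have hm0 : (0 : ℝ) < m := by exact_mod_cast hm
  set w := √y with hw
  have hw0 : 0 < w := Real.sqrt_pos.2 hy.1
  have hwy : w ^ 2 = y := Real.sq_sqrt hy.1.le
  have hw1 : w ≤ 1 := by nlinarith [hy.2]
  set φ := Real.arcsin w with hφ
  have hsin : Real.sin φ = w := Real.sin_arcsin (by linarith) hw1
  have hφ0 : 0 ≤ φ := Real.arcsin_nonneg.2 hw0.le
  have hφ1 : φ ≤ Real.pi / 2 := Real.arcsin_le_pi_div_two w
  have key := hK φ
  rw [hsin, hwy] at key
  refine ⟨?_, ?_, ?_, fun hle => ?_⟩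
  · exact nonneg_of_mul_nonneg_right (key ▸ sq_nonneg _) hy.1
  · rw [key]; exact Real.sin_sq_le_one _
  · have h := abs_sin_natCast_mul_le m φ
    rw [hsin, abs_of_pos hw0] at h
    have h2 := pow_le_pow_left₀ (abs_nonneg _) h 2
    rw [sq_abs, mul_pow, hwy, ← key, mul_comm] at h2
    exact le_of_mul_le_mul_right h2 hy.1
  · have hpi := Real.pi_pos
    have hmw : m * w ≤ 1 := by
      rw [le_div_iff₀ (by positivity)] at hle
      have : (m * w) ^ 2 ≤ 1 := by rw [mul_pow, hwy]; linarith
      exact (sq_le_one_iff₀ (by positivity)).1 this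
    have h1 := Real.mul_le_sin hφ0 hφ1
    rw [hsin] at h1
    have h2 : φ ≤ Real.pi / 2 * w := by
      rw [div_mul_eq_mul_div, div_le_iff₀ hpi] at h1
      linarith
    have h3 : m * φ ≤ Real.pi / 2 := by nlinarith
    have h4 := Real.mul_le_sin (by positivity) h3
    have h5 : w ≤ φ := hsin ▸ Real.sin_le hφ0
    have h6 : 1 / 2 ≤ 2 / Real.pi := by
      rw [div_le_div_iff₀ two_pos hpi]; linarith [Real.pi_le_four]
    have h7 : 1 / 2 * (m * w) ≤ Real.sin (m * φ) :=
      le_trans (by gcongr) h4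
    have h8 := pow_le_pow_left₀ (by positivity) h7 2
    rw [← key, mul_pow, mul_pow, hwy] at h8
    refine le_of_mul_le_mul_left ?_ hy.1
    linarith

theorem integral_rational_le (m : ℝ) (hm : 0 < m) :
    ∫ y in (0 : ℝ)..1, 4 * m ^ 4 / (1 + m ^ 2 * y) ^ 2 ≤ 4 * m ^ 2 := by
  have hne : ∀ y ∈ Set.uIcc (0 : ℝ) 1, 1 + m ^ 2 * y ≠ 0 := fun y hy => by
    rw [Set.uIcc_of_le zero_le_one] at hy
    have := hy.1
    positivity
  have hderiv : ∀ y ∈ Set.uIcc (0 : ℝ) 1, HasDerivAt (fun y => -(4 * m ^ 2) / (1 + m ^ 2 * y))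
      (4 * m ^ 4 / (1 + m ^ 2 * y) ^ 2) y := fun y hy => by
    have h := (((hasDerivAt_id y).const_mul (m ^ 2)).const_add 1).inv (hne y hy)
    have h2 := h.const_mul (-(4 * m ^ 2))
    refine (h2.congr_deriv ?_).congr_of_eventuallyEq
      (Filter.Eventually.of_forall fun z => by simp [div_eq_mul_inv])
    have := hne y hy
    simp only [id]
    field_simp
  rw [intervalIntegral.integral_eq_sub_of_hasDerivAt hderiv]
  · have : 0 ≤ 4 * m ^ 2 / (1 + m ^ 2 * 1) := by positivity
    simp only [neg_div, mul_zero, add_zero, div_one]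
    linarith
  · refine ContinuousOn.intervalIntegrable ?_
    exact continuousOn_const.div (by fun_prop) fun y hy => pow_ne_zero _ (hne y hy)

open Polynomial in
theorem exists_concentrated_polynomial (r m : ℕ) (hm : 1 ≤ m) :
    ∃ q : ℝ[X], q.natDegree ≤ (2 * r + 4) * (m - 1) ∧ (∀ x, 0 ≤ q.eval x) ∧
      0 < ∫ x in (0 : ℝ)..1, (1 - x) ^ r * q.eval x ∧
      ∫ x in (0 : ℝ)..1, (1 - x) ^ (r + 1) * q.eval x ≤
        4 ^ (2 * r + 5) * (r + 1) / (m : ℝ) ^ 2 * ∫ x in (0 : ℝ)..1, (1 - x) ^ r * q.eval x := by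
  obtain ⟨K, hdeg, hK⟩ := exists_peaked_polynomial m hm
  have hm1 : (1 : ℝ) ≤ m := by exact_mod_cast hm
  have hm0 : (0 : ℝ) < m := by linarith
  have hflip : ∀ j : ℕ, ∫ x in (0 : ℝ)..1, (1 - x) ^ j *
      ((K.comp (1 - X)) ^ (2 * r + 4)).eval x =
      ∫ y in (0 : ℝ)..1, y ^ j * K.eval y ^ (2 * r + 4) := by
    intro j
    have := intervalIntegral.integral_comp_sub_left (a := 0) (b := 1)
      (fun y : ℝ => y ^ j * K.eval y ^ (2 * r + 4)) 1
    simpa using this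
  have hcont : ∀ j : ℕ, Continuous fun y : ℝ => y ^ j * K.eval y ^ (2 * r + 4) := fun j => by
    have := K.continuous
    fun_prop
  have hm2 : 1 / (m : ℝ) ^ 2 ≤ 1 := by
    rw [div_le_one (by positivity)]; exact one_le_pow₀ hm1
  have hlower : (m : ℝ) ^ (2 * r + 6) / (4 ^ (2 * r + 4) * (r + 1)) ≤
      ∫ y in (0 : ℝ)..1, y ^ r * K.eval y ^ (2 * r + 4) := by
    calc (m : ℝ) ^ (2 * r + 6) / (4 ^ (2 * r + 4) * (r + 1))
        = ∫ y in (0 : ℝ)..(1 / (m : ℝ) ^ 2), y ^ r * ((m : ℝ) ^ 2 / 4) ^ (2 * r + 4) := by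
          rw [intervalIntegral.integral_mul_const, integral_pow, zero_pow (by omega), sub_zero,
            div_pow, div_pow, one_pow]
          field_simp
          ring
      _ ≤ ∫ y in (0 : ℝ)..(1 / (m : ℝ) ^ 2), y ^ r * K.eval y ^ (2 * r + 4) := by
          refine intervalIntegral.integral_mono_on_of_le_Ioo (by positivity)
            (Continuous.intervalIntegrable (by fun_prop) _ _)
            ((hcont r).intervalIntegrable _ _) fun y hy => ?_
          have hy0 := hy.1
          have := (hK y ⟨hy.1, hy.2.trans_le hm2⟩).2.2.2 hy.2.le
          gcongr
      _ ≤ _ := by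
          refine intervalIntegral.integral_mono_interval le_rfl (by positivity) hm2 ?_
            ((hcont r).intervalIntegrable _ _)
          refine (MeasureTheory.ae_restrict_iff' measurableSet_Ioc).2
            (Filter.Eventually.of_forall fun y hy => ?_)
          exact mul_nonneg (pow_nonneg hy.1.le _) (Even.pow_nonneg ⟨r + 2, by ring⟩ _)
  have hupper : ∫ y in (0 : ℝ)..1, y ^ (r + 1) * K.eval y ^ (2 * r + 4) ≤
      4 * (m : ℝ) ^ (2 * r + 4) := by
    calc ∫ y in (0 : ℝ)..1, y ^ (r + 1) * K.eval y ^ (2 * r + 4)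
        ≤ ∫ y in (0 : ℝ)..1, (m : ℝ) ^ (2 * r + 2) *
            (4 * (m : ℝ) ^ 4 / (1 + (m : ℝ) ^ 2 * y) ^ 2) := by
          refine intervalIntegral.integral_mono_on_of_le_Ioo zero_le_one
            ((hcont _).intervalIntegrable _ _) ?_ fun y hy => ?_
          · refine ContinuousOn.intervalIntegrable ?_
            refine continuousOn_const.mul (continuousOn_const.div (by fun_prop) fun y hy => ?_)
            rw [Set.uIcc_of_le zero_le_one] at hy
            have := hy.1
            positivity
          · obtain ⟨h0, h1, h2, -⟩ := hK y hy
            have hy0 := hy.1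
            have e : y ^ (r + 1) * K.eval y ^ (2 * r + 4) =
                (y * K.eval y) ^ (r + 1) * K.eval y ^ (r + 1) * K.eval y ^ 2 := by
              rw [mul_pow]; ring
            rw [e]
            have h3 : (y * K.eval y) ^ (r + 1) ≤ 1 := pow_le_one₀ (by positivity) h1
            have h4 : K.eval y ^ (r + 1) ≤ (m : ℝ) ^ (2 * r + 2) := by
              refine (pow_le_pow_left₀ h0 h2 _).trans_eq ?_
              rw [← pow_mul]; congr 1
            have h5 : K.eval y ^ 2 ≤ 4 * (m : ℝ) ^ 4 / (1 + (m : ℝ) ^ 2 * y) ^ 2 := by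
              rw [le_div_iff₀ (by positivity), ← mul_pow,
                show 4 * (m : ℝ) ^ 4 = (2 * (m : ℝ) ^ 2) ^ 2 by ring]
              refine pow_le_pow_left₀ (by positivity) ?_ 2
              nlinarith [mul_le_mul_of_nonneg_left h1 (sq_nonneg (m : ℝ))]
            refine mul_le_mul ?_ h5 (by positivity) (by positivity)
            exact (mul_le_mul h3 h4 (by positivity) zero_le_one).trans_eq (one_mul _)
      _ ≤ (m : ℝ) ^ (2 * r + 2) * (4 * (m : ℝ) ^ 2) := by
          rw [intervalIntegral.integral_const_mul]
          exact mul_le_mul_of_nonneg_left (integral_rational_le _ hm0) (by positivity)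
      _ = _ := by ring
  refine ⟨(K.comp (1 - X)) ^ (2 * r + 4), ?_, fun x => ?_, ?_, ?_⟩
  · refine natDegree_pow_le.trans (Nat.mul_le_mul_left _ (natDegree_comp_le.trans ?_))
    have hlin : (1 - X : ℝ[X]).natDegree ≤ 1 := by compute_degree
    exact (Nat.mul_le_mul hdeg hlin).trans_eq (mul_one _)
  · rw [eval_pow]
    exact Even.pow_nonneg ⟨r + 2, by ring⟩ _
  · rw [hflip]
    exact lt_of_lt_of_le (by positivity) hlower
  · rw [hflip, hflip]
    refine hupper.trans (le_trans (le_of_eq ?_) (mul_le_mul_of_nonneg_left hlower (by positivity)))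
    field_simp
    ring

open Polynomial in
theorem iteratedDeriv_eval (P : ℝ[X]) (ν : ℕ) :
    iteratedDeriv ν (fun y => P.eval y) = fun y => (derivative^[ν] P).eval y := by
  induction ν with
  | zero => simp
  | succ ν ih =>
    rw [iteratedDeriv_succ, ih, Function.iterate_succ_apply']
    funext x
    exact Polynomial.deriv _

theorem one_sub_pow_le (μ : ℕ) {x : ℝ} (hx : x ∈ Set.Icc (0 : ℝ) 1) :
    1 - x ^ μ ≤ μ * (1 - x) := by
  have h := one_add_mul_le_pow (a := x - 1) (by linarith [hx.1]) μ
  rw [add_sub_cancel] at h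
  linarith

open Polynomial in
theorem one_sub_moment_le {P : ℝ[X]} (hP : ∀ x ∈ Set.Icc (0 : ℝ) 1, 0 ≤ P.eval x)
    (h1 : ∫ x in (0 : ℝ)..1, P.eval x = 1) (μ : ℕ) :
    1 - ∫ x in (0 : ℝ)..1, x ^ μ * P.eval x ≤
      μ * ∫ x in (0 : ℝ)..1, (1 - x) * P.eval x := by
  have hc := P.continuous
  conv_lhs => enter [1]; rw [← h1]
  rw [← intervalIntegral.integral_sub (hc.intervalIntegrable _ _)
    (Continuous.intervalIntegrable (by fun_prop) _ _), ← intervalIntegral.integral_const_mul]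
  refine intervalIntegral.integral_mono_on zero_le_one
    (Continuous.intervalIntegrable (by fun_prop) _ _)
    (Continuous.intervalIntegrable (by fun_prop) _ _) fun x hx => ?_
  nlinarith [mul_le_mul_of_nonneg_right (one_sub_pow_le μ hx) (hP x hx)]

open Polynomial in
theorem exists_monotone_density (r m : ℕ) (hm : 1 ≤ m) :
    ∃ P : ℝ[X], P.natDegree ≤ (2 * r + 4) * (m - 1) + r ∧
      (∀ ν ≤ r, ∀ x ∈ Set.Icc (0 : ℝ) 1, 0 ≤ (derivative^[ν] P).eval x) ∧
      (∫ x in (0 : ℝ)..1, P.eval x) = 1 ∧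
      ∫ x in (0 : ℝ)..1, (1 - x) * P.eval x ≤ 4 ^ (2 * r + 5) / (m : ℝ) ^ 2 := by
  obtain ⟨q, hqdeg, hq0, hqpos, hq⟩ := exists_concentrated_polynomial r m hm
  obtain ⟨P, hdeg, hpos, hmom⟩ := exists_iterated_antiderivative q (fun x _ => hq0 x) r
  have hm0 : (0 : ℝ) < m := by exact_mod_cast hm
  have hfac : (0 : ℝ) < r.factorial := by exact_mod_cast r.factorial_pos
  have h0 := hmom 0
  have h1 := hmom 1
  rw [add_comm 1 r, Nat.factorial_succ] at h1
  simp only [zero_add, pow_zero, one_mul, Nat.factorial_zero, Nat.cast_one, pow_one,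
    Nat.factorial_one] at h0 h1
  push_cast at h1
  rw [← h0] at hq hqpos
  rw [← h1] at hq
  set M := ∫ x in (0 : ℝ)..1, P.eval x with hM
  have hM0 : 0 < M := (mul_pos_iff_of_pos_left hfac).1 hqpos
  refine ⟨C M⁻¹ * P, (natDegree_C_mul_le _ _).trans (by omega), fun ν hν x hx => ?_, ?_, ?_⟩
  · rw [iterate_derivative_C_mul, eval_mul, eval_C]
    exact mul_nonneg (by positivity) (hpos ν hν x hx)
  · simp only [eval_mul, eval_C]
    rw [intervalIntegral.integral_const_mul, ← hM, inv_mul_cancel₀ hM0.ne']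
  · simp only [eval_mul, eval_C, mul_left_comm _ M⁻¹]
    rw [intervalIntegral.integral_const_mul, inv_mul_le_iff₀ hM0]
    have hpf : (0 : ℝ) < (r + 1) * r.factorial := by positivity
    refine le_of_mul_le_mul_left (hq.trans_eq ?_) hpf
    ring

theorem statement12 (r : ℕ) (hr : 1 ≤ r) :
    ∃ c : ℕ → ℝ, (∀ μ : ℕ, 1 ≤ μ → 0 < c μ) ∧
      ∀ n : ℕ, 1 ≤ n → ∃ P : Polynomial ℝ, P.natDegree ≤ n ∧
        (∀ ν ≤ r, ∀ x ∈ I01, 0 ≤ iteratedDeriv ν (fun y => P.eval y) x) ∧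
        (∫ x in (0 : ℝ)..1, P.eval x) = 1 ∧
        ∀ μ : ℕ, 1 ≤ μ →
          1 - (∫ x in (0 : ℝ)..1, x ^ μ * P.eval x) ≤ c μ / (n : ℝ) ^ 2 := by
  refine ⟨fun μ => μ * (4 ^ (2 * r + 5) * (3 * r + 4) ^ 2), fun μ hμ => ?_, fun n hn => ?_⟩
  · have : (0 : ℝ) < μ := by exact_mod_cast hμ
    positivity
  have hn0 : (0 : ℝ) < n := by exact_mod_cast hn
  suffices h : ∃ P : Polynomial ℝ, P.natDegree ≤ n ∧
      (∀ ν ≤ r, ∀ x ∈ Set.Icc (0 : ℝ) 1, 0 ≤ (Polynomial.derivative^[ν] P).eval x) ∧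
      (∫ x in (0 : ℝ)..1, P.eval x) = 1 ∧
      ∫ x in (0 : ℝ)..1, (1 - x) * P.eval x ≤
        4 ^ (2 * r + 5) * (3 * r + 4) ^ 2 / (n : ℝ) ^ 2 by
    obtain ⟨P, hdeg, hpos, hmass, hmom⟩ := h
    refine ⟨P, hdeg, fun ν hν x hx => ?_, hmass, fun μ _ => ?_⟩
    · rw [iteratedDeriv_eval]
      exact hpos ν hν x hx
    · refine (one_sub_moment_le (hpos 0 (Nat.zero_le _)) hmass μ).trans ?_
      rw [mul_div_assoc]
      exact mul_le_mul_of_nonneg_left hmom (Nat.cast_nonneg _)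
  rcases lt_or_ge n r with hnr | hnr
  · refine ⟨1, by simp, fun ν _ x _ => ?_, by simp, ?_⟩
    · rcases ν with _ | ν
      · simp
      · simp [Function.iterate_succ_apply]
    · have hnr' : (n : ℝ) ≤ 3 * r + 4 := by
        have : (n : ℝ) ≤ r := by exact_mod_cast hnr.le
        linarith
      have h1 : (1 : ℝ) ≤ 4 ^ (2 * r + 5) := one_le_pow₀ (by norm_num)
      have h2 : (n : ℝ) ^ 2 ≤ (3 * r + 4) ^ 2 := pow_le_pow_left₀ hn0.le hnr' 2
      have h3 : (1 : ℝ) ≤ 4 ^ (2 * r + 5) * (3 * r + 4) ^ 2 / (n : ℝ) ^ 2 := by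
        rw [one_le_div (by positivity)]
        nlinarith [sq_nonneg (3 * (r : ℝ) + 4)]
      refine le_trans ?_ h3
      calc ∫ x in (0 : ℝ)..1, (1 - x) * (1 : Polynomial ℝ).eval x
          ≤ ∫ _ in (0 : ℝ)..1, (1 : ℝ) := by
            refine intervalIntegral.integral_mono_on zero_le_one
              (Continuous.intervalIntegrable (by simp only [Polynomial.eval_one]; fun_prop) _ _)
              (by simp) fun x hx => ?_
            simp [hx.1]
        _ = 1 := by simp
  · have hdiv := Nat.mul_div_le (n - r) (2 * r + 4)
    have hlt := Nat.lt_mul_div_succ (n - r) (show 0 < 2 * r + 4 by omega)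
    generalize (n - r) / (2 * r + 4) = k at hdiv hlt
    obtain ⟨P, hdeg, hpos, hmass, hmom⟩ := exists_monotone_density r (k + 1) (by omega)
    refine ⟨P, hdeg.trans ?_, hpos, hmass, hmom.trans ?_⟩
    · rw [Nat.add_sub_cancel]
      omega
    · have hnm : n ≤ (3 * r + 4) * (k + 1) := by nlinarith [Nat.sub_add_cancel hnr]
      have hnm' : (n : ℝ) ≤ (3 * r + 4) * (k + 1 : ℕ) := by exact_mod_cast hnm
      rw [div_le_div_iff₀ (by positivity) (by positivity), mul_assoc, ← mul_pow]
      gcongr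
end
end

section
/- For each μ ∈ ℕ there is a constant c > 0 (depending only on μ) such that for every n ∈ ℕ and every polynomial P_n of degree ≤ n with P_n(x) ≥ 0 for all x ∈ [0,1] and ∫₀¹ P_n(x) dx = 1, one has 1 − ∫₀¹ x^μ P_n(x) dx ≥ c/n². -/
noncomputable section

open Set Finset
open scoped Classical

open Polynomial in
theorem exists_antiderivative_s13 {n : ℕ} {P : ℝ[X]} (hP : P.natDegree ≤ n) :
    ∃ G : ℝ[X], G.natDegree ≤ n + 1 ∧ derivative G = P ∧ G.eval 0 = 0 := by
  refine ⟨∑ i ∈ Finset.range (n + 1), monomial (i + 1) (P.coeff i / (i + 1)), ?_, ?_, ?_⟩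
  · refine natDegree_sum_le_of_forall_le _ _ fun i hi => (natDegree_monomial_le _).trans ?_
    have := Finset.mem_range.1 hi
    omega
  · conv_rhs => rw [P.as_sum_range' (n + 1) (by omega)]
    rw [derivative_sum]
    refine Finset.sum_congr rfl fun i _ => ?_
    rw [derivative_monomial, Nat.add_sub_cancel]
    push_cast
    rw [div_mul_cancel₀ _ (by positivity)]
  · simp [eval_finsetSum]

open Polynomial in
/-- A pointwise bound for nonnegative polynomials of unit mass on `[0, 1]`, obtained from the
endpoint case of Markov's inequality on `[0, t]`. -/
theorem mul_eval_le_of_nonneg_of_integral_eq_one {n : ℕ} {P : ℝ[X]} (hP : P.natDegree ≤ n)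
    (hnonneg : ∀ x ∈ I01, 0 ≤ P.eval x) (hint : (∫ x in (0 : ℝ)..1, P.eval x) = 1)
    {t : ℝ} (ht : t ∈ I01) : t * P.eval t ≤ ((n : ℝ) + 1) ^ 2 := by
  obtain ⟨G, hGdeg, hGP, hG0⟩ := exists_antiderivative_s13 hP
  have hG1 : G.eval 1 = 1 := by
    have h := intervalIntegral.integral_eq_sub_of_hasDerivAt (a := 0) (b := 1)
      (f := fun x => G.eval x) (f' := fun x => P.eval x)
      (fun x _ => by simpa [hGP] using G.hasDerivAt x) (P.continuous.intervalIntegrable _ _)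
    simp only [hint, hG0] at h
    linarith
  have hmono : MonotoneOn (fun x => G.eval x) I01 := by
    refine monotoneOn_of_deriv_nonneg (convex_Icc 0 1) G.continuous.continuousOn
      G.differentiable.differentiableOn fun x hx => ?_
    rw [Polynomial.deriv, hGP]
    exact hnonneg x (interior_subset hx)
  set R : ℝ[X] := C 2 * G.comp (C (t / 2) * (X + C 1)) - C 1 with hR
  have hRdeg : R.degree ≤ ((n + 1 : ℕ) : WithBot ℕ) := by
    refine natDegree_le_iff_degree_le.1 ?_
    have hlin : (C (t / 2) * (X + C 1) : ℝ[X]).natDegree ≤ 1 := by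
      compute_degree
    rw [hR, natDegree_sub_C]
    refine (natDegree_C_mul_le _ _).trans (natDegree_comp_le.trans ?_)
    nlinarith
  have hRbnd : ∀ x ∈ Set.Icc (-1 : ℝ) 1, |R.eval x| ≤ 1 := by
    rintro x ⟨hx₁, hx₂⟩
    have hmem : t / 2 * (x + 1) ∈ I01 := by
      obtain ⟨h₀, h₁⟩ := ht
      constructor <;> nlinarith
    have h₀ := hmono (show (0 : ℝ) ∈ I01 by simp [I01]) hmem hmem.1
    have h₁ := hmono hmem (show (1 : ℝ) ∈ I01 by simp [I01]) hmem.2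
    simp only [hG0, hG1] at h₀ h₁
    have hx : R.eval x = 2 * G.eval (t / 2 * (x + 1)) - 1 := by simp [hR]
    rw [hx, abs_le]
    constructor <;> linarith
  have h := Chebyshev.eval_iterate_derivative_le_of_forall_abs_le_one (k := 1) le_rfl hRdeg hRbnd
  simp only [Function.iterate_one, Chebyshev.derivative_T_eval_one] at h
  have hd : (derivative R).eval 1 = t * P.eval t := by
    simp only [hR, derivative_sub, derivative_C, derivative_mul, derivative_comp, hGP,
      derivative_add, derivative_X, eval_add, eval_mul, eval_comp, eval_C, eval_X,
      eval_one, zero_mul, zero_add, add_zero, sub_zero]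
    rw [show t / 2 * (1 + 1) = t by ring]
    ring
  rw [hd] at h
  exact_mod_cast h

theorem inv_le_integral_one_sub_mul {n : ℕ} {P : Polynomial ℝ} (hP : P.natDegree ≤ n)
    (hnonneg : ∀ x ∈ I01, 0 ≤ P.eval x) (hint : (∫ x in (0 : ℝ)..1, P.eval x) = 1) :
    1 / (8 * ((n : ℝ) + 1) ^ 2) ≤ ∫ x in (0 : ℝ)..1, (1 - x) * P.eval x := by
  set M : ℝ := ((n : ℝ) + 1) ^ 2 with hM
  have hM1 : 1 ≤ M := by rw [hM]; nlinarith [(Nat.cast_nonneg n : (0 : ℝ) ≤ n)]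
  set h : ℝ := 1 / (4 * M) with hh
  have hhM : h * M = 1 / 4 := by rw [hh]; field_simp
  have hpos : 0 < h := by positivity
  have hle : h ≤ 1 / 2 := by nlinarith
  have hI : ∀ a b : ℝ, IntervalIntegrable (fun x => P.eval x) MeasureTheory.volume a b :=
    fun a b => P.continuous.intervalIntegrable a b
  have hJ : ∀ a b : ℝ, IntervalIntegrable (fun x => (1 - x) * P.eval x) MeasureTheory.volume a b :=
    fun a b => ((continuous_const.sub continuous_id).mul P.continuous).intervalIntegrable a b
  have hsplit := intervalIntegral.integral_add_adjacent_intervals (hI 0 (1 - h)) (hI (1 - h) 1)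
  have hsplit' := intervalIntegral.integral_add_adjacent_intervals (hJ 0 (1 - h)) (hJ (1 - h) 1)
  have htail : ∫ x in (1 - h)..1, P.eval x ≤ ∫ _ in (1 - h)..1, 2 * M := by
    refine intervalIntegral.integral_mono_on (by linarith) (hI _ _) (by simp) fun x hx => ?_
    have hxI : x ∈ I01 := ⟨by linarith [hx.1], hx.2⟩
    have := mul_eval_le_of_nonneg_of_integral_eq_one hP hnonneg hint hxI
    nlinarith [hnonneg x hxI, hx.1]
  have hmain : ∫ x in (0 : ℝ)..(1 - h), h * P.eval x ≤
      ∫ x in (0 : ℝ)..(1 - h), (1 - x) * P.eval x := by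
    refine intervalIntegral.integral_mono_on (by linarith) ((hI _ _).const_mul h) (hJ _ _)
      fun x hx => ?_
    exact mul_le_mul_of_nonneg_right (by linarith [hx.2])
      (hnonneg x ⟨hx.1, by linarith [hx.2]⟩)
  have htail' : 0 ≤ ∫ x in (1 - h)..1, (1 - x) * P.eval x := by
    refine intervalIntegral.integral_nonneg (by linarith) fun x hx => ?_
    exact mul_nonneg (by linarith [hx.2]) (hnonneg x ⟨by linarith [hx.1], hx.2⟩)
  rw [intervalIntegral.integral_const_mul] at hmain
  rw [intervalIntegral.integral_const, smul_eq_mul] at htail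
  have heq : 1 / (8 * M) = h * (1 / 2) := by rw [hh]; field_simp; norm_num
  rw [heq]
  have : 1 / 2 ≤ ∫ x in (0 : ℝ)..(1 - h), P.eval x := by linarith
  nlinarith

theorem statement13 (μ : ℕ) (hμ : 1 ≤ μ) :
    ∃ c : ℝ, 0 < c ∧ ∀ n : ℕ, 1 ≤ n → ∀ P : Polynomial ℝ, P.natDegree ≤ n →
      (∀ x ∈ I01, 0 ≤ P.eval x) → (∫ x in (0 : ℝ)..1, P.eval x) = 1 →
      c / (n : ℝ) ^ 2 ≤ 1 - ∫ x in (0 : ℝ)..1, x ^ μ * P.eval x := by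
  refine ⟨1 / 32, by norm_num, fun n hn P hP hnonneg hint => ?_⟩
  have hn' : (1 : ℝ) ≤ n := by exact_mod_cast hn
  have hI : ∀ k : ℕ, IntervalIntegrable (fun x => x ^ k * P.eval x) MeasureTheory.volume 0 1 :=
    fun k => ((continuous_pow k).mul P.continuous).intervalIntegrable 0 1
  have hmono : ∫ x in (0 : ℝ)..1, (1 - x) * P.eval x ≤
      ∫ x in (0 : ℝ)..1, (P.eval x - x ^ μ * P.eval x) := by
    refine intervalIntegral.integral_mono_on zero_le_one
      (((continuous_const.sub continuous_id).mul P.continuous).intervalIntegrable 0 1)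
      ((P.continuous.intervalIntegrable 0 1).sub (hI μ)) fun x hx => ?_
    have hpow : x ^ μ ≤ x := pow_le_of_le_one hx.1 hx.2 (by omega)
    nlinarith [hnonneg x hx]
  rw [intervalIntegral.integral_sub (P.continuous.intervalIntegrable 0 1) (hI μ), hint] at hmono
  refine le_trans ?_ ((inv_le_integral_one_sub_mul hP hnonneg hint).trans hmono)
  rw [div_div]
  exact one_div_le_one_div_of_le (by positivity) (by nlinarith)
end
end

section
/- Let α > −1. The shifted normalized ultraspherical polynomial φ_n^{(α)} admits the Bernstein-basis expansion: φ_n^{(α)}(x) = (α+1)_n · Σ_{k=0}^n ((−1)^{n−k} / ((α+1)_k (α+1)_{n−k})) p_{n,k}(x) for all x. -/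
noncomputable section

open Set Finset
open scoped Classical

/-- The Pochhammer symbol `(x)_k = x(x+1)⋯(x+k-1)`. -/
def poch (x : ℝ) (k : ℕ) : ℝ := (ascPochhammer ℝ k).eval x

/-- The shifted ultraspherical polynomial on `[0,1]`, normalized so that `φ_n^{(α)}(1) = 1`,
given on `(0,1)` by the Rodrigues-type formula
`φ_n^{(α)}(x) = ((-1)^n/(α+1)_n) x^{-α}(1-x)^{-α} (d^n/dx^n)[x^{n+α}(1-x)^{n+α}]`. -/
def ultra (α : ℝ) (n : ℕ) (x : ℝ) : ℝ :=
  (-1 : ℝ) ^ n / poch (α + 1) n * x ^ (-α) * (1 - x) ^ (-α) *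
    iteratedDeriv n (fun y : ℝ => y ^ ((n : ℝ) + α) * (1 - y) ^ ((n : ℝ) + α)) x

theorem poch_pos {x : ℝ} (hx : 0 < x) (k : ℕ) : 0 < poch x k :=
  ascPochhammer_pos k x hx

theorem poch_mul_eval_descPochhammer (α : ℝ) {n k : ℕ} (hk : k ≤ n) :
    poch (α + 1) (n - k) * (descPochhammer ℝ k).eval ((n : ℝ) + α) = poch (α + 1) n := by
  have h := congrArg (Polynomial.eval (α + 1)) (ascPochhammer_mul (S := ℝ) (n - k) k)
  rw [Nat.sub_add_cancel hk] at h
  simp only [Polynomial.eval_mul, Polynomial.eval_comp, Polynomial.eval_add, Polynomial.eval_X,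
    Polynomial.eval_natCast] at h
  rw [poch, poch, ← h, descPochhammer_eval_eq_ascPochhammer, Nat.cast_sub hk]
  congr 2
  ring

theorem iteratedDeriv_rpow_add (α : ℝ) (hα : -1 < α) {n k : ℕ} (hk : k ≤ n) {x : ℝ}
    (hx : 0 < x) :
    iteratedDeriv k (fun y : ℝ => y ^ ((n : ℝ) + α)) x =
      poch (α + 1) n / poch (α + 1) (n - k) * (x ^ (n - k) * x ^ α) := by
  have hp := (poch_pos (by linarith : 0 < α + 1) (n - k)).ne'
  rw [iteratedDeriv_eq_iterate, Real.iter_deriv_rpow_const,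
    ← poch_mul_eval_descPochhammer α hk, mul_div_cancel_left₀ _ hp, ← Real.rpow_natCast,
    ← Real.rpow_add hx, Nat.cast_sub hk]
  congr 2
  ring

theorem iteratedDeriv_one_sub_rpow_add (α : ℝ) (hα : -1 < α) {n k : ℕ} (hk : k ≤ n) {x : ℝ}
    (hx : x < 1) :
    iteratedDeriv k (fun y : ℝ => (1 - y) ^ ((n : ℝ) + α)) x =
      (-1) ^ k * (poch (α + 1) n / poch (α + 1) (n - k) *
        ((1 - x) ^ (n - k) * (1 - x) ^ α)) := by
  have h := congrFun
    (iteratedDeriv_comp_const_sub k (fun y : ℝ => y ^ ((n : ℝ) + α)) 1) x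
  rw [← iteratedDeriv_rpow_add α hα hk (sub_pos.2 hx)]
  simpa using h

theorem statement14 (α : ℝ) (hα : -1 < α) (n : ℕ) :
    ∀ x ∈ Set.Ioo (0 : ℝ) 1,
      ultra α n x = poch (α + 1) n *
        ∑ k ∈ Finset.range (n + 1),
          (-1 : ℝ) ^ (n - k) / (poch (α + 1) k * poch (α + 1) (n - k)) * bern n k x := by
  rintro x ⟨hx0, hx1⟩
  have hy0 : 0 < 1 - x := sub_pos.2 hx1
  have hf : ContDiffAt ℝ n (fun y : ℝ => y ^ ((n : ℝ) + α)) x :=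
    Real.contDiffAt_rpow_const_of_ne hx0.ne'
  have hg : ContDiffAt ℝ n (fun y : ℝ => (1 - y) ^ ((n : ℝ) + α)) x :=
    (contDiffAt_const.sub contDiffAt_id).rpow_const_of_ne hy0.ne'
  have hp : ∀ k, poch (α + 1) k ≠ 0 := fun k => (poch_pos (by linarith) k).ne'
  rw [ultra, iteratedDeriv_fun_mul hf hg, Finset.mul_sum, Finset.mul_sum,
    ← Finset.sum_range_reflect]
  refine Finset.sum_congr rfl fun k hk => ?_
  obtain ⟨m, rfl⟩ : ∃ m, n = k + m :=
    Nat.exists_eq_add_of_le (Nat.lt_succ_iff.1 (Finset.mem_range.1 hk))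
  have e1 : k + m + 1 - 1 - k = m := by omega
  have e2 : k + m - m = k := by omega
  have e3 : k + m - k = m := by omega
  rw [e1, iteratedDeriv_rpow_add α hα (Nat.le_add_left m k) hx0, e2,
    iteratedDeriv_one_sub_rpow_add α hα (Nat.le_add_right k m) hx1, e3, bern, e3,
    ← Nat.choose_symm_add, Real.rpow_neg hx0.le, Real.rpow_neg hy0.le]
  have hxa := (Real.rpow_pos_of_pos hx0 α).ne'
  have hya := (Real.rpow_pos_of_pos hy0 α).ne'
  have hs : (-1 : ℝ) ^ (k + m) * (-1) ^ k = (-1) ^ m := by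
    rw [pow_add, mul_right_comm, ← mul_pow]
    simp
  rw [← hs]
  have := hp k
  have := hp m
  have := hp (k + m)
  field_simp
end
end
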